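/- Let (X_t) be the edge-reinforced random walk on (G, v0, A), and for T ≥ 1 let H(X_0^T) denote the Shannon entropy (natural logarithm) of its trajectory law on V^{T+1}. Then the entropy rate r(v0,A) := lim_{T→∞} (1/T)·H(X_0^T) exists and equals −∫ Σ_{{i,j}∈E} (w_{ij} / Σ_{e∈E} w_e) · log( w_{ij} / √(w_i·w_j) ) dμ_{v0,A}(w). Equivalently, r(v0,A) = E_{W∼μ_{v0,A}}[ r(P_W) ], where r(P_w) := −Σ_{i∈V} π_i(w) Σ_{j∈V} p_{ij}(w) log p_{ij}(w) is the entropy rate of the quenched chain P_w. -/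

import Mathlib

open MeasureTheory Real Filter
open scoped ENNReal NNReal Classical BigOperators

noncomputable section

namespace ERRW

variable {V : Type*} [Fintype V] [DecidableEq V]

/-- Total weight at a vertex: sum of the edge weights over the edges incident to `i`. -/
def vw (G : SimpleGraph V) [DecidableRel G.Adj] (w : Sym2 V → ℝ) (i : V) : ℝ :=
  ∑ j ∈ G.neighborFinset i, w s(i, j)

/-- Product of a vertex function over the two endpoints of an unordered pair. -/
def sprod (f : V → ℝ) : Sym2 V → ℝ :=
  Sym2.lift ⟨fun i j => f i * f j, fun i j => mul_comm _ _⟩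

/-- Sum of a vertex function over the two endpoints of an unordered pair. -/
def ssum (f : V → ℝ) : Sym2 V → ℝ :=
  Sym2.lift ⟨fun i j => f i + f j, fun i j => add_comm _ _⟩

/-- Quenched transition probability `p_{ij}(w) = w_{ij}/w_i`. -/
def qstep (G : SimpleGraph V) [DecidableRel G.Adj] (w : Sym2 V → ℝ) (i j : V) : ℝ :=
  if G.Adj i j then w s(i, j) / vw G w i else 0

/-- Stationary distribution `π_i(w) = w_i / Σ_v w_v` of the quenched chain. -/
def statDist (G : SimpleGraph V) [DecidableRel G.Adj] (w : Sym2 V → ℝ) (i : V) : ℝ :=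
  vw G w i / ∑ v : V, vw G w v

/-- Spanning trees of `G`, as edge sets. -/
def spanningTrees (G : SimpleGraph V) [DecidableRel G.Adj] : Finset (Finset (Sym2 V)) :=
  G.edgeFinset.powerset.filter fun F =>
    (SimpleGraph.fromEdgeSet (F : Set (Sym2 V))).IsTree

/-- Spanning-tree polynomial `τ(w) = Σ_{T} Π_{e ∈ T} w_e`. -/
def tau (G : SimpleGraph V) [DecidableRel G.Adj] (w : Sym2 V → ℝ) : ℝ :=
  ∑ F ∈ spanningTrees G, ∏ e ∈ F, w e

/-- Vertex parameter `b_v = (B_v + 1 - 𝟙(v = x))/2`. -/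
def bwt (G : SimpleGraph V) [DecidableRel G.Adj] (x : V) (B : Sym2 V → ℝ) (v : V) : ℝ :=
  (vw G B v + 1 - if v = x then 1 else 0) / 2

/-- The normalizing constant `Z_{x,B}` of the magic formula. -/
def Znorm (G : SimpleGraph V) [DecidableRel G.Adj] (x : V) (B : Sym2 V → ℝ) : ℝ :=
  ((∏ e ∈ G.edgeFinset, Real.Gamma (B e)) /
      ∏ v : V, Real.Gamma (bwt G x B v)) *
    Real.pi ^ (((Fintype.card V : ℝ) - 1) / 2) /
    2 ^ ((1 : ℝ) - (Fintype.card V : ℝ) + ∑ e ∈ G.edgeFinset, B e)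

/-- The magic-formula density of `μ_{x,B}` with respect to `Π_{e ≠ e0} dw_e`. -/
def magicDensity (G : SimpleGraph V) [DecidableRel G.Adj] (x : V) (B : Sym2 V → ℝ)
    (w : Sym2 V → ℝ) : ℝ :=
  (Znorm G x B)⁻¹ * (vw G w x) ^ ((1 : ℝ) / 2) *
      (∏ e ∈ G.edgeFinset, w e ^ (B e - 1)) /
      (∏ v : V, (vw G w v) ^ ((vw G B v + 1) / 2)) *
    Real.sqrt (tau G w)

/-- Coordinates indexed by the non-reference edges. -/
abbrev Epin (G : SimpleGraph V) [DecidableRel G.Adj] (e0 : Sym2 V) :=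
  {e : Sym2 V // e ∈ G.edgeFinset ∧ e ≠ e0}

/-- Extension of non-reference edge coordinates to a pinned environment (`w_{e0} = 1`). -/
def pinExt (G : SimpleGraph V) [DecidableRel G.Adj] (e0 : Sym2 V)
    (u : Epin G e0 → ℝ) : Sym2 V → ℝ :=
  fun e => if e = e0 then 1 else if h : e ∈ G.edgeFinset ∧ e ≠ e0 then u ⟨e, h⟩ else 0

/-- The mixing measure `μ_{x,B}` of the magic formula, as a measure on
environments pinned at the reference edge `e0`. -/
def mixing (G : SimpleGraph V) [DecidableRel G.Adj] (e0 : Sym2 V) (x : V) (B : Sym2 V → ℝ) :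
    Measure (Sym2 V → ℝ) :=
  Measure.map (pinExt G e0)
    ((volume : Measure (Epin G e0 → ℝ)).withDensity fun u =>
      ENNReal.ofReal
        (if ∀ e ∈ G.edgeFinset, 0 < pinExt G e0 u e then
          magicDensity G x B (pinExt G e0 u) else 0))

/-- Kullback–Leibler divergence (natural logarithm), `+∞` if `P` is not
absolutely continuous with respect to `Q`. -/
def KL {Ω : Type*} [MeasurableSpace Ω] (P Q : Measure Ω) : EReal :=
  if P ≪ Q then ((∫ x, Real.log (P.rnDeriv Q x).toReal ∂P : ℝ) : EReal) else ⊤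

/-- Edge local time (current edge weight) at time `t` along a path. -/
def localTime (a : Sym2 V → ℝ) (x : ℕ → V) (t : ℕ) (e : Sym2 V) : ℝ :=
  a e + ((Finset.range t).filter fun k => s(x k, x (k + 1)) = e).card

/-- One-step ERRW conditional probability at time `t` given the past of the path. -/
def errwStep (G : SimpleGraph V) [DecidableRel G.Adj] (a : Sym2 V → ℝ) (x : ℕ → V)
    (t : ℕ) : ℝ :=
  if G.Adj (x t) (x (t + 1)) then
    localTime a x t s(x t, x (t + 1)) /
      ∑ u ∈ G.neighborFinset (x t), localTime a x t s(x t, u)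
  else 0

/-- Extension of a finite path to ℕ (junk value `v0` beyond time `T`). -/
def extendPath {T : ℕ} (v0 : V) (x : Fin (T + 1) → V) : ℕ → V :=
  fun t => if h : t < T + 1 then x ⟨t, h⟩ else v0

/-- ERRW trajectory probability of a length-`T` path (the trajectory law mass function). -/
def errwProb (G : SimpleGraph V) [DecidableRel G.Adj] (v0 : V) (a : Sym2 V → ℝ) (T : ℕ)
    (x : Fin (T + 1) → V) : ℝ :=
  if x 0 = v0 then ∏ t ∈ Finset.range T, errwStep G a (extendPath v0 x) t else 0

/-- Undirected traversal count `N_e` of an edge along a finite path. -/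
def edgeCount {T : ℕ} (v0 : V) (x : Fin (T + 1) → V) (e : Sym2 V) : ℕ :=
  ((Finset.range T).filter fun k =>
    s(extendPath v0 x k, extendPath v0 x (k + 1)) = e).card

/-- Quenched path probability of a length-`T` path started at `v0`. -/
def quenchedProb (G : SimpleGraph V) [DecidableRel G.Adj] (v0 : V) (w : Sym2 V → ℝ) (T : ℕ)
    (x : Fin (T + 1) → V) : ℝ :=
  if x 0 = v0 then
    ∏ t ∈ Finset.range T, qstep G w (extendPath v0 x t) (extendPath v0 x (t + 1))
  else 0

/-- The measure on a finite type determined by a mass function. -/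
def discreteMeasure {Ω : Type*} [Fintype Ω] [MeasurableSpace Ω] (p : Ω → ℝ) : Measure Ω :=
  ∑ x : Ω, ENNReal.ofReal (p x) • Measure.dirac x

/-- Digamma function `Ψ = (log Γ)'`. -/
def digamma (x : ℝ) : ℝ := deriv (fun y => Real.log (Real.Gamma y)) x

/-- Trigamma function `Ψ₁ = Ψ'`. -/
def trigamma (x : ℝ) : ℝ := deriv digamma x

/-- `Λ(p,q) = log Γ(q) − log Γ(p) − (q−p)·Ψ(p)`. -/
def Lam (p q : ℝ) : ℝ :=
  Real.log (Real.Gamma q) - Real.log (Real.Gamma p) - (q - p) * digamma p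

set_option linter.unusedSectionVars false

/-- The multiplicative Haar measure `dt / t` on `(0, ∞)`, as a measure on `ℝ`. -/
def mulHaar : Measure ℝ := Measure.map Real.exp volume

lemma measurableEmbedding_exp : MeasurableEmbedding Real.exp :=
  Real.continuous_exp.measurableEmbedding Real.exp_injective

instance : SigmaFinite mulHaar :=
  measurableEmbedding_exp.sigmaFinite_map

lemma lintegral_mulHaar (f : ℝ → ℝ≥0∞) : ∫⁻ t, f t ∂mulHaar = ∫⁻ x, f (Real.exp x) :=
  measurableEmbedding_exp.lintegral_map _

lemma ae_mulHaar_pos : ∀ᵐ t ∂mulHaar, 0 < t := by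
  refine (ae_map_iff Real.measurable_exp.aemeasurable measurableSet_Ioi).2 ?_
  exact Eventually.of_forall fun x => Real.exp_pos x

lemma setLIntegral_Ioi_eq_mulHaar (f : ℝ → ℝ≥0∞) :
    ∫⁻ t in Set.Ioi 0, f t = ∫⁻ t, ENNReal.ofReal t * f t ∂mulHaar := by
  rw [lintegral_mulHaar]
  have h := lintegral_image_eq_lintegral_abs_deriv_mul (s := Set.univ) (f := Real.exp)
    (f' := Real.exp) MeasurableSet.univ
    (fun x _ => (Real.hasDerivAt_exp x).hasDerivWithinAt) Real.exp_injective.injOn f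
  rw [Set.image_univ, Real.range_exp, Measure.restrict_univ] at h
  rw [h]
  simp only [abs_of_pos (Real.exp_pos _)]

lemma mulHaar_mul {c : ℝ} (hc : 0 < c) : MeasurePreserving (fun t => c * t) mulHaar mulHaar := by
  refine ⟨by fun_prop, ?_⟩
  rw [mulHaar, Measure.map_map (by fun_prop) (by fun_prop)]
  have : (fun t => c * t) ∘ Real.exp = Real.exp ∘ fun x => Real.log c + x := by
    ext x
    simp [Real.exp_add, Real.exp_log hc]
  rw [this, ← Measure.map_map (by fun_prop) (by fun_prop), map_add_left_eq_self]

lemma mulHaar_inv : MeasurePreserving (fun t : ℝ => t⁻¹) mulHaar mulHaar := by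
  refine ⟨by fun_prop, ?_⟩
  rw [mulHaar, Measure.map_map (by fun_prop) (by fun_prop)]
  have : (fun t : ℝ => t⁻¹) ∘ Real.exp = Real.exp ∘ fun x => -x := by
    ext x
    simp [Real.exp_neg]
  rw [this, ← Measure.map_map (by fun_prop) (by fun_prop)]
  congr 1
  exact (Measure.measurePreserving_neg (volume : Measure ℝ)).map_eq

/-- The product of multiplicative Haar measures. -/
abbrev piHaar (ι : Type*) [Fintype ι] : Measure (ι → ℝ) := Measure.pi fun _ => mulHaar

lemma ae_piHaar_pos (ι : Type*) [Fintype ι] : ∀ᵐ w ∂piHaar ι, ∀ i, 0 < w i :=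
  eventually_all.2 fun _ => Measure.tendsto_eval_ae_ae.eventually ae_mulHaar_pos

lemma piHaar_mul {ι : Type*} [Fintype ι] {c : ι → ℝ} (hc : ∀ i, 0 < c i) :
    MeasurePreserving (fun (w : ι → ℝ) i => c i * w i) (piHaar ι) (piHaar ι) :=
  measurePreserving_pi _ _ fun i => mulHaar_mul (hc i)

lemma lintegral_piHaar_mul {ι : Type*} [Fintype ι] {c : ι → ℝ} (hc : ∀ i, 0 < c i)
    {f : (ι → ℝ) → ℝ≥0∞} (hf : Measurable f) :
    ∫⁻ w, f (fun i => c i * w i) ∂piHaar ι = ∫⁻ w, f w ∂piHaar ι :=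
  (piHaar_mul hc).lintegral_comp hf

lemma lintegral_piHaar_equiv {ι κ : Type*} [Fintype ι] [Fintype κ] (e : ι ≃ κ)
    (f : (κ → ℝ) → ℝ≥0∞) :
    ∫⁻ w, f w ∂piHaar κ = ∫⁻ w, f (fun k => w (e.symm k)) ∂piHaar ι := by
  have h := measurePreserving_piCongrLeft (fun _ : κ => mulHaar) e
  rw [← h.lintegral_comp_emb (MeasurableEquiv.measurableEmbedding _)]
  refine lintegral_congr fun w => ?_
  congr 1
  ext k
  obtain ⟨i, rfl⟩ := e.surjective k
  simp [MeasurableEquiv.coe_piCongrLeft, Equiv.piCongrLeft_apply_apply]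

lemma lintegral_pi_fin_succ (μ : Measure ℝ) [SigmaFinite μ] {n : ℕ}
    {f : (Fin (n + 1) → ℝ) → ℝ≥0∞} (hf : Measurable f) :
    ∫⁻ w, f w ∂Measure.pi (fun _ : Fin (n + 1) => μ) =
      ∫⁻ y, ∫⁻ t, f (Fin.cons t y) ∂μ ∂Measure.pi (fun _ : Fin n => μ) := by
  have h := (measurePreserving_piFinSuccAbove (fun _ : Fin (n + 1) => μ) 0).symm
  rw [← h.lintegral_comp hf, lintegral_prod_symm]
  · simp [MeasurableEquiv.piFinSuccAbove_symm_apply]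
    rfl
  · exact (hf.comp h.measurable).aemeasurable

lemma lintegral_piHaar_option {ι : Type*} [Fintype ι]
    {f : (Option ι → ℝ) → ℝ≥0∞} (hf : Measurable f) :
    ∫⁻ w, f w ∂piHaar (Option ι) =
      ∫⁻ y, ∫⁻ t, f (fun o => o.elim t y) ∂mulHaar ∂piHaar ι := by
  have h := Measure.pi_map_piOptionEquivProd (fun _ : Option ι => mulHaar)
  rw [piHaar, ← h, lintegral_map_equiv, lintegral_prod]
  · refine lintegral_congr fun y => lintegral_congr fun t => ?_
    congr 1
    ext o
    cases o <;> rfl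
  · exact (hf.comp (MeasurableEquiv.measurable _)).aemeasurable

lemma lintegral_pi_prod {ι : Type*} [Fintype ι] (μ : Measure ℝ) [SigmaFinite μ]
    {f : ι → ℝ → ℝ≥0∞} (hf : ∀ i, Measurable (f i)) :
    ∫⁻ w, ∏ i, f i (w i) ∂Measure.pi (fun _ : ι => μ) = ∏ i, ∫⁻ t, f i t ∂μ := by
  have key : ∀ (n : ℕ) (f : Fin n → ℝ → ℝ≥0∞), (∀ i, Measurable (f i)) →
      ∫⁻ w, ∏ i, f i (w i) ∂Measure.pi (fun _ : Fin n => μ) = ∏ i, ∫⁻ t, f i t ∂μ := by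
    intro n
    induction n with
    | zero => intro f hf; simp
    | succ n ih =>
      intro f hf
      rw [lintegral_pi_fin_succ μ (by fun_prop)]
      simp only [Fin.prod_univ_succ, Fin.cons_zero, Fin.cons_succ]
      rw [← ih _ fun i => hf _, ← lintegral_const_mul _ (by fun_prop)]
      refine lintegral_congr fun y => ?_
      rw [lintegral_mul_const _ (hf 0)]
  have e := (Fintype.equivFin ι).symm
  have h := measurePreserving_piCongrLeft (fun _ : ι => μ) e
  rw [← h.lintegral_comp_emb (MeasurableEquiv.measurableEmbedding _), ← e.prod_comp]
  rw [← key _ _ fun i => hf (e i)]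
  refine lintegral_congr fun w => ?_
  rw [← e.prod_comp]
  simp [MeasurableEquiv.coe_piCongrLeft, Equiv.piCongrLeft_apply_apply]

lemma setLIntegral_pos_eq_piHaar {ι : Type*} [Fintype ι]
    {f : (ι → ℝ) → ℝ≥0∞} (hf : Measurable f) :
    ∫⁻ w in Set.univ.pi (fun _ => Set.Ioi 0), f w =
      ∫⁻ w, (∏ i, ENNReal.ofReal (w i)) * f w ∂piHaar ι := by
  have h1 : (volume : Measure (ι → ℝ)).restrict (Set.univ.pi (fun _ => Set.Ioi 0)) =
      (piHaar ι).withDensity fun w => ∏ i, ENNReal.ofReal (w i) := by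
    rw [volume_pi, Measure.restrict_pi_pi]
    refine Measure.pi_eq fun s hs => ?_
    rw [withDensity_apply _ (MeasurableSet.univ_pi hs), ← lintegral_indicator
      (MeasurableSet.univ_pi hs)]
    have : ∀ w : ι → ℝ, (Set.univ.pi s).indicator (fun w => ∏ i, ENNReal.ofReal (w i)) w =
        ∏ i, (s i).indicator ENNReal.ofReal (w i) := by
      intro w
      by_cases hw : w ∈ Set.univ.pi s
      · rw [Set.indicator_of_mem hw]
        exact Finset.prod_congr rfl fun i _ => (Set.indicator_of_mem (hw i trivial) _).symm
      · rw [Set.indicator_of_notMem hw]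
        simp only [Set.mem_pi, Set.mem_univ, true_implies, not_forall] at hw
        obtain ⟨i, hi⟩ := hw
        exact (Finset.prod_eq_zero (Finset.mem_univ i) (Set.indicator_of_notMem hi _)).symm
    rw [lintegral_congr this, lintegral_pi_prod _
      fun i => ENNReal.measurable_ofReal.indicator (hs i)]
    refine Finset.prod_congr rfl fun i _ => ?_
    rw [← lintegral_indicator_one (hs i), setLIntegral_Ioi_eq_mulHaar]
    refine lintegral_congr fun t => ?_
    by_cases ht : t ∈ s i <;> simp [ht]
  rw [h1, lintegral_withDensity_eq_lintegral_mul _ (by fun_prop) hf]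
  rfl

lemma lintegral_mulHaar_rpow_mul_exp {p b c : ℝ} (hp : 0 < p) (hb : 0 < b) (hc : 0 < c) :
    ∫⁻ t, ENNReal.ofReal (t ^ b * Real.exp (-(c * t ^ p))) ∂mulHaar =
      ENNReal.ofReal (c ^ (-(b / p)) * (1 / p) * Real.Gamma (b / p)) := by
  have h1 : ∫⁻ t, ENNReal.ofReal (t ^ b * Real.exp (-(c * t ^ p))) ∂mulHaar =
      ∫⁻ t in Set.Ioi 0, ENNReal.ofReal (t ^ (b - 1) * Real.exp (-c * t ^ p)) := by
    rw [setLIntegral_Ioi_eq_mulHaar]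
    refine lintegral_congr_ae (ae_mulHaar_pos.mono fun t ht => ?_)
    simp only
    rw [← ENNReal.ofReal_mul ht.le, ← mul_assoc, ← Real.rpow_one_add' ht.le (by linarith)]
    simp
  have h2 := integral_rpow_mul_exp_neg_mul_rpow hp (by linarith : -1 < b - 1) hc
  rw [sub_add_cancel] at h2
  rw [h1, ← ofReal_integral_eq_lintegral_ofReal, h2, neg_div]
  · exact integrableOn_rpow_mul_exp_neg_mul_rpow (by linarith) hp hc
  · refine (ae_restrict_mem measurableSet_Ioi).mono fun t ht => ?_
    have : (0:ℝ) < t := ht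
    positivity

lemma lintegral_mulHaar_gamma {b c : ℝ} (hb : 0 < b) (hc : 0 < c) :
    ∫⁻ t, ENNReal.ofReal (t ^ b * Real.exp (-(c * t))) ∂mulHaar =
      ENNReal.ofReal (c ^ (-b) * Real.Gamma b) := by
  have h := lintegral_mulHaar_rpow_mul_exp one_pos hb hc
  simpa using h

lemma lintegral_mulHaar_gamma_sq {b c : ℝ} (hb : 0 < b) (hc : 0 < c) :
    ∫⁻ y, ENNReal.ofReal (y ^ (-(2 * b)) * Real.exp (-(c / y ^ 2))) ∂mulHaar =
      ENNReal.ofReal (c ^ (-b) * (1 / 2) * Real.Gamma b) := by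
  have h := lintegral_mulHaar_rpow_mul_exp two_pos (mul_pos two_pos hb) hc
  rw [mul_div_cancel_left₀ _ two_ne_zero] at h
  rw [← h, ← mulHaar_inv.lintegral_comp (by fun_prop)]
  refine lintegral_congr_ae (ae_mulHaar_pos.mono fun t ht => ?_)
  simp only
  rw [Real.inv_rpow ht.le, ← Real.rpow_neg ht.le, neg_neg]
  simp [div_eq_mul_inv]

lemma lintegral_inverseGaussian {c : ℝ} (hc : 0 < c) :
    ∫⁻ t, ENNReal.ofReal (√t * Real.exp (-t - c ^ 2 / (4 * t))) ∂mulHaar =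
      ENNReal.ofReal (√π * Real.exp (-c)) := by
  set G : ℝ → ℝ := fun x => √(c / 2) * Real.exp (-c * Real.cosh x) with hG
  have hG0 : ∀ x, 0 ≤ G x := fun x => by positivity
  have h1 : ∫⁻ t, ENNReal.ofReal (√t * Real.exp (-t - c ^ 2 / (4 * t))) ∂mulHaar =
      ∫⁻ x, ENNReal.ofReal (Real.exp (x / 2) * G x) := by
    rw [← (mulHaar_mul (half_pos hc)).lintegral_comp (by fun_prop), lintegral_mulHaar]
    refine lintegral_congr fun x => ?_
    have e1 : √(c / 2 * Real.exp x) = √(c / 2) * Real.exp (x / 2) := by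
      rw [Real.sqrt_mul (by positivity), Real.exp_half]
    have e2 : -(c / 2 * Real.exp x) - c ^ 2 / (4 * (c / 2 * Real.exp x)) = -c * Real.cosh x := by
      rw [Real.cosh_eq, Real.exp_neg]
      field_simp
      ring
    rw [e1, e2]
    congr 1
    simp only [hG]
    ring
  have h2 : ∫⁻ x, ENNReal.ofReal (Real.exp (x / 2) * G x) =
      ∫⁻ x, ENNReal.ofReal (Real.exp (-x / 2) * G x) := by
    rw [← lintegral_neg_eq_self]
    simp [hG]
  have h3 : ∫⁻ x, ENNReal.ofReal (Real.exp (x / 2) * G x) =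
      ∫⁻ x, ENNReal.ofReal (Real.cosh (x / 2) * G x) := by
    refine (ENNReal.mul_right_inj (a := 2) (by simp) (by simp)).1 ?_
    conv_lhs => rw [two_mul]
    conv_lhs => enter [2]; rw [h2]
    rw [← lintegral_add_left (by fun_prop), ← lintegral_const_mul _ (by fun_prop)]
    refine lintegral_congr fun x => ?_
    have := hG0 x
    rw [← ENNReal.ofReal_add (by positivity) (by positivity),
      show (2 : ℝ≥0∞) = ENNReal.ofReal 2 by simp, ← ENNReal.ofReal_mul (by norm_num), Real.cosh_eq]
    congr 1
    rw [neg_div]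
    ring
  have h4 : ∫⁻ x, ENNReal.ofReal (Real.cosh (x / 2) * G x) =
      ∫⁻ v : ℝ, ENNReal.ofReal (√(c / 2) * Real.exp (-c) * 2 * Real.exp (-(2 * c) * v ^ 2)) := by
    have hs : Function.Surjective fun x : ℝ => Real.sinh (x / 2) := fun y =>
      ⟨2 * Real.arsinh y, by simp⟩
    have hd : ∀ x ∈ Set.univ, HasDerivWithinAt (fun x : ℝ => Real.sinh (x / 2))
        (Real.cosh (x / 2) * (1 / 2)) Set.univ x := fun x _ =>
      (((Real.hasDerivAt_sinh _).comp x ((hasDerivAt_id x).div_const 2))).hasDerivWithinAt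
    have hi : Function.Injective fun x : ℝ => Real.sinh (x / 2) := fun x y h => by
      have := Real.sinh_injective h
      linarith
    have h := lintegral_image_eq_lintegral_abs_deriv_mul MeasurableSet.univ hd hi.injOn
      (fun v : ℝ => ENNReal.ofReal (√(c / 2) * Real.exp (-c) * 2 * Real.exp (-(2 * c) * v ^ 2)))
    rw [Set.image_univ, hs.range_eq, Measure.restrict_univ] at h
    rw [h]
    refine lintegral_congr fun x => ?_
    rw [← ENNReal.ofReal_mul (abs_nonneg _),
      abs_of_pos (by have := Real.cosh_pos (x / 2); positivity)]
    congr 1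
    have e : Real.cosh x = 1 + 2 * Real.sinh (x / 2) ^ 2 := by
      have := Real.cosh_two_mul (x / 2)
      rw [mul_div_cancel₀ _ two_ne_zero, Real.cosh_sq] at this
      linarith
    simp only [hG]
    rw [e,
      show -c * (1 + 2 * Real.sinh (x / 2) ^ 2) = -c + -(2 * c) * Real.sinh (x / 2) ^ 2 by ring,
      Real.exp_add]
    ring
  rw [h1, h3, h4, ← ofReal_integral_eq_lintegral_ofReal, integral_const_mul, integral_gaussian]
  · congr 1
    have : √(π / (2 * c)) * (√(c / 2) * 2) = √π := by
      rw [show (2:ℝ) = √4 by rw [show (4:ℝ) = 2 ^ 2 by norm_num]; simp,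
        ← Real.sqrt_mul (by positivity), ← Real.sqrt_mul (by positivity)]
      congr 1
      rw [show √4 = (2:ℝ) by rw [show (4:ℝ) = 2 ^ 2 by norm_num]; simp]
      field_simp
      norm_num
    rw [← this]
    ring
  · exact (integrable_exp_neg_mul_sq (by linarith)).const_mul _
  · exact Eventually.of_forall fun v => by positivity

lemma measurable_det {α ι : Type*} [MeasurableSpace α] [Fintype ι] [DecidableEq ι]
    {M : α → Matrix ι ι ℝ} (h : ∀ i j, Measurable fun p => M p i j) :
    Measurable fun p => (M p).det := by
  simp only [Matrix.det_apply']
  exact Finset.measurable_sum _ fun σ _ =>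
    measurable_const.mul (Finset.measurable_prod _ fun i _ => h _ _)

/-- The Laplacian of the conductances `y i * W i j * y j`, grounded through the conductances
`y i * η i`. -/
def groundedLap {ι : Type*} [Fintype ι] [DecidableEq ι] (W : ι → ι → ℝ) (η y : ι → ℝ) :
    Matrix ι ι ℝ :=
  Matrix.of fun i j =>
    (if i = j then y i * ((∑ k, W i k * y k) + η i) else 0) - y i * W i j * y j

/-- The integrand of the supersymmetric localization identity `lintegral_fieldDensity`. -/
def fieldDensity {ι : Type*} [Fintype ι] [DecidableEq ι] (W : ι → ι → ℝ) (η y : ι → ℝ) : ℝ :=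
  Real.exp (-(∑ i, ((∑ k, W i k * y k) + η i) / y i) / 2 - (∑ i, η i * y i) / 2) *
    √(groundedLap W η y).det * ∏ i, (y i)⁻¹

lemma measurable_fieldDensity {ι : Type*} [Fintype ι] [DecidableEq ι] (W : ι → ι → ℝ)
    (η : ι → ℝ) : Measurable (fieldDensity W η) := by
  have : Measurable fun y => (groundedLap W η y).det := measurable_det fun i j => by
    by_cases hij : i = j <;> simp only [groundedLap, Matrix.of_apply, hij, if_true, if_false] <;>
      fun_prop
  unfold fieldDensity
  fun_prop

/-- The conductances after eliminating vertex `0`. -/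
def elimW {n : ℕ} (W : Fin (n + 1) → Fin (n + 1) → ℝ) (s : ℝ) (i j : Fin n) : ℝ :=
  W i.succ j.succ + s * (W 0 i.succ * W 0 j.succ)

/-- The grounding after eliminating vertex `0`. -/
def elimEta {n : ℕ} (W : Fin (n + 1) → Fin (n + 1) → ℝ) (η : Fin (n + 1) → ℝ) (s : ℝ)
    (i : Fin n) : ℝ :=
  η i.succ + s * (η 0 * W 0 i.succ)

lemma sum_elimW_mul {n : ℕ} (W : Fin (n + 1) → Fin (n + 1) → ℝ) (s : ℝ) (y : Fin n → ℝ)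
    (i : Fin n) : ∑ k, elimW W s i k * y k =
      (∑ k : Fin n, W i.succ k.succ * y k) + s * W 0 i.succ * ∑ k, W 0 k.succ * y k := by
  rw [Finset.mul_sum, ← Finset.sum_add_distrib]
  refine Finset.sum_congr rfl fun k _ => ?_
  simp only [elimW]; ring

lemma det_groundedLap_cons {n : ℕ} {W : Fin (n + 1) → Fin (n + 1) → ℝ}
    (hW : ∀ i j, W i j = W j i) (η : Fin (n + 1) → ℝ) (s : ℝ) (y : Fin n → ℝ) {g : ℝ}
    (hg : g = (∑ i, W 0 i.succ * y i) + η 0) (hg0 : g ≠ 0) :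
    (groundedLap W η (Fin.cons (g * s) y)).det =
      s * g ^ 2 * (groundedLap (elimW W s) (elimEta W η s) y).det := by
  set L := groundedLap W η (Fin.cons (g * s) y) with hL
  have hsum : ∀ i : Fin (n + 1), ∑ k, W i k * (Fin.cons (g * s) y : Fin (n + 1) → ℝ) k =
      W i 0 * (g * s) + ∑ k : Fin n, W i k.succ * y k := fun i => by
    rw [Fin.sum_univ_succ]; simp
  have h00 : L 0 0 = s * g ^ 2 := by
    simp only [hL, groundedLap, Matrix.of_apply, hsum, Fin.cons_zero, if_true]
    linear_combination (-g * s) * hg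
  have h0j : ∀ j : Fin n, L 0 j.succ = -(s * g * W 0 j.succ * y j) := fun j => by
    simp only [hL, groundedLap, Matrix.of_apply, Fin.cons_zero, Fin.cons_succ,
      (Fin.succ_ne_zero j).symm, if_false]
    ring
  have hi0 : ∀ i : Fin n, L i.succ 0 = -(s * g * W 0 i.succ * y i) := fun i => by
    simp only [hL, groundedLap, Matrix.of_apply, Fin.cons_zero, Fin.cons_succ,
      (Fin.succ_ne_zero i), if_false, hW i.succ 0]
    ring
  let c : Fin (n + 1) → ℝ := Fin.cons 0 fun i => -(W 0 i.succ * y i) / g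
  let B : Matrix (Fin (n + 1)) (Fin (n + 1)) ℝ := fun i j => L i j - c i * L 0 j
  have hB0 : ∀ j, B 0 j = L 0 j := fun j => by simp [B, c]
  have hdet : L.det = B.det := by
    refine Matrix.det_eq_of_forall_row_eq_smul_add_const c 0 rfl fun i j => ?_
    rw [hB0]
    simp [B]
  rw [hdet, Matrix.det_succ_column_zero, Fin.sum_univ_succ, Finset.sum_eq_zero, add_zero]
  · have hsub : B.submatrix (Fin.succAbove 0) Fin.succ =
        groundedLap (elimW W s) (elimEta W η s) y := by
      ext i j
      have hcL : c i.succ * L 0 j.succ = s * (y i * (W 0 i.succ * W 0 j.succ) * y j) := by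
        rw [h0j]
        simp only [c, Fin.cons_succ]
        field_simp
      change L i.succ j.succ - c i.succ * L 0 j.succ = _
      rw [hcL]
      simp only [hL, groundedLap, Matrix.of_apply, Fin.cons_succ, Fin.succ_inj, hsum, sum_elimW_mul,
        elimEta, hW i.succ 0]
      simp only [elimW]
      by_cases hij : i = j
      · simp only [hij, if_true]
        linear_combination (y j * W 0 j.succ * s) * hg
      · simp only [hij, if_false]
        ring
    rw [hsub, hB0, h00]
    simp
  · intro i _
    have : B i.succ 0 = 0 := by
      simp only [B, hi0, h00, c, Fin.cons_succ]
      field_simp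
      ring
    simp [this]

lemma fieldDensity_cons {n : ℕ} {W : Fin (n + 1) → Fin (n + 1) → ℝ}
    (hW : ∀ i j, W i j = W j i) (η : Fin (n + 1) → ℝ) {b : ℝ} (hb : 0 < b) {y : Fin n → ℝ} {g : ℝ}
    (hg : g = (∑ i, W 0 i.succ * y i) + η 0) (hg0 : 0 < g) :
    fieldDensity W η (Fin.cons (g / 2 * b⁻¹) y) =
      √2 * √b * Real.exp (-b - η 0 ^ 2 / (4 * b) - W 0 0 / 2) *
        fieldDensity (elimW W (1 / (2 * b))) (elimEta W η (1 / (2 * b))) y := by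
  set s := 1 / (2 * b) with hs
  have hs0 : 0 < s := by positivity
  have ht : g / 2 * b⁻¹ = g * s := by rw [hs]; field_simp
  have hbs : b = 1 / (2 * s) := by rw [hs]; field_simp
  rw [ht]
  unfold fieldDensity
  rw [det_groundedLap_cons hW η s y hg hg0.ne', Real.sqrt_mul (by positivity),
    Real.sqrt_mul hs0.le, Real.sqrt_sq hg0.le, Fin.prod_univ_succ]
  simp only [Fin.cons_zero, Fin.cons_succ]
  have h1 : √s * g * (g * s)⁻¹ = √2 * √b := by
    rw [← Real.sqrt_mul (by norm_num), hbs, show 2 * (1 / (2 * s)) = s⁻¹ by field_simp,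
      Real.sqrt_inv]
    have := Real.sq_sqrt hs0.le
    have h0 : 0 < √s := by positivity
    field_simp
    linarith
  have hsum : ∀ i : Fin (n + 1), ∑ k, W i k * (Fin.cons (g * s) y : Fin (n + 1) → ℝ) k =
      W i 0 * (g * s) + ∑ k : Fin n, W i k.succ * y k := fun i => by
    rw [Fin.sum_univ_succ]; simp
  have h2 : ∀ i : Fin n, (∑ k, elimW W s i k * y k) + elimEta W η s i =
      (∑ k, W i.succ k * (Fin.cons (g * s) y : Fin (n + 1) → ℝ) k) + η i.succ := fun i => by
    rw [sum_elimW_mul, hsum, hW i.succ 0]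
    simp only [elimEta]
    linear_combination (-W 0 i.succ * s) * hg
  have h3 : ∑ i, elimEta W η s i * y i = (∑ i : Fin n, η i.succ * y i) + s * η 0 * (g - η 0) := by
    rw [hg, add_sub_cancel_right, Finset.mul_sum, ← Finset.sum_add_distrib]
    refine Finset.sum_congr rfl fun k _ => ?_
    simp only [elimEta]; ring
  have h4 : -(∑ i, ((∑ k, W i k * (Fin.cons (g * s) y : Fin (n + 1) → ℝ) k) + η i) /
        (Fin.cons (g * s) y : Fin (n + 1) → ℝ) i) / 2 -
        (∑ i, η i * (Fin.cons (g * s) y : Fin (n + 1) → ℝ) i) / 2 =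
      (-b - η 0 ^ 2 / (4 * b) - W 0 0 / 2) +
      (-(∑ i, ((∑ k, elimW W s i k * y k) + elimEta W η s i) / y i) / 2 -
        (∑ i, elimEta W η s i * y i) / 2) := by
    rw [h3, Fin.sum_univ_succ, Fin.sum_univ_succ (f := fun i => η i * _)]
    simp only [h2, Fin.cons_zero, Fin.cons_succ]
    have : ((∑ k, W 0 k * (Fin.cons (g * s) y : Fin (n + 1) → ℝ) k) + η 0) / (g * s) =
        W 0 0 + 2 * b := by
      rw [hsum, add_assoc, ← hg, hbs]
      field_simp
    rw [this, hbs]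
    field_simp
    ring
  rw [h4, Real.exp_add, ← h1]
  ring

/-- Every nonempty set of vertices is connected by `W` or `η` to its outside. -/
def Grounded {ι : Type*} (W : ι → ι → ℝ) (η : ι → ℝ) : Prop :=
  ∀ S : Set ι, S.Nonempty → ∃ i ∈ S, 0 < η i ∨ ∃ j ∉ S, 0 < W i j

lemma Grounded.elim {n : ℕ} {W : Fin (n + 1) → Fin (n + 1) → ℝ} {η : Fin (n + 1) → ℝ}
    (hW : ∀ i j, W i j = W j i) (hW0 : ∀ i j, 0 ≤ W i j) (hη0 : ∀ i, 0 ≤ η i)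
    (h : Grounded W η) {s : ℝ} (hs : 0 < s) : Grounded (elimW W s) (elimEta W η s) := by
  have hW' : ∀ i j, W i.succ j.succ ≤ elimW W s i j := fun i j =>
    le_add_of_nonneg_right (mul_nonneg hs.le (mul_nonneg (hW0 _ _) (hW0 _ _)))
  have hη' : ∀ i, η i.succ ≤ elimEta W η s i := fun i =>
    le_add_of_nonneg_right (mul_nonneg hs.le (mul_nonneg (hη0 _) (hW0 _ _)))
  intro S hS
  obtain ⟨_, ⟨i, hi, rfl⟩, hi' | ⟨j, hj, hij⟩⟩ := h (Fin.succ '' S) (hS.image _)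
  · exact ⟨i, hi, .inl (hi'.trans_le (hη' i))⟩
  rcases Fin.eq_zero_or_eq_succ j with rfl | ⟨j, rfl⟩
  swap
  · exact ⟨i, hi, .inr ⟨j, fun h => hj ⟨j, h, rfl⟩, hij.trans_le (hW' i j)⟩⟩
  have hmem : ∀ j : Fin n, j.succ ∉ insert 0 (Fin.succ '' S) → j ∉ S := fun j h hjS =>
    h (.inr ⟨j, hjS, rfl⟩)
  obtain ⟨k, hk, hk'⟩ := h (insert 0 (Fin.succ '' S)) ⟨0, .inl rfl⟩
  rw [hW] at hij
  rcases hk with rfl | ⟨k, hk, rfl⟩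
  · rcases hk' with h0 | ⟨j, hj, h0j⟩
    · exact ⟨i, hi, .inl (add_pos_of_nonneg_of_pos (hη0 _) (by positivity))⟩
    · rcases Fin.eq_zero_or_eq_succ j with rfl | ⟨j, rfl⟩
      · exact absurd (Set.mem_insert _ _) hj
      · exact ⟨i, hi, .inr ⟨j, hmem j hj, add_pos_of_nonneg_of_pos (hW0 _ _) (by positivity)⟩⟩
  · rcases hk' with h0 | ⟨j, hj, h0j⟩
    · exact ⟨k, hk, .inl (h0.trans_le (hη' k))⟩
    · rcases Fin.eq_zero_or_eq_succ j with rfl | ⟨j, rfl⟩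
      · exact absurd (Set.mem_insert _ _) hj
      · exact ⟨k, hk, .inr ⟨j, hmem j hj, h0j.trans_le (hW' k j)⟩⟩

lemma lintegral_fieldDensity_fin {n : ℕ} : ∀ {W : Fin n → Fin n → ℝ} {η : Fin n → ℝ},
    (∀ i j, W i j = W j i) → (∀ i j, 0 ≤ W i j) → (∀ i, 0 ≤ η i) → Grounded W η →
    ∫⁻ y, ENNReal.ofReal (fieldDensity W η y) ∂piHaar (Fin n) =
      ENNReal.ofReal (√(2 * π) ^ n * Real.exp (-(∑ i, ∑ j, W i j) / 2 - ∑ i, η i)) := by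
  induction n with
  | zero => intro W η _ _ _ _; simp [fieldDensity]
  | succ n ih =>
    intro W η hW hW0 hη0 hG
    have hm := measurable_fieldDensity W η
    have hg : ∀ y : Fin n → ℝ, (∀ i, 0 < y i) → 0 < (∑ i, W 0 i.succ * y i) + η 0 := by
      intro y hy
      have hnn : ∀ i ∈ Finset.univ, 0 ≤ W 0 i.succ * y i := fun i _ =>
        mul_nonneg (hW0 _ _) (hy i).le
      obtain ⟨i, hi, h0 | ⟨j, hj, h0⟩⟩ := hG {0} ⟨0, rfl⟩
      · rw [Set.mem_singleton_iff] at hi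
        subst hi
        exact add_pos_of_nonneg_of_pos (Finset.sum_nonneg hnn) h0
      · rw [Set.mem_singleton_iff] at hi hj
        subst hi
        obtain ⟨j, rfl⟩ := Fin.exists_succ_eq.2 hj
        refine add_pos_of_pos_of_nonneg ?_ (hη0 0)
        exact Finset.sum_pos' hnn ⟨j, Finset.mem_univ _, mul_pos h0 (hy j)⟩
    have h1 : ∫⁻ y, ENNReal.ofReal (fieldDensity W η y) ∂piHaar (Fin (n + 1)) =
        ∫⁻ y, ∫⁻ b, ENNReal.ofReal (fieldDensity W η
          (Fin.cons (((∑ i, W 0 i.succ * y i) + η 0) / 2 * b⁻¹) y)) ∂mulHaar ∂piHaar (Fin n) := by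
      rw [piHaar, lintegral_pi_fin_succ _ (by fun_prop)]
      refine lintegral_congr_ae ((ae_piHaar_pos _).mono fun y hy => ?_)
      have hc : Measurable fun t : ℝ => (Fin.cons t y : Fin (n + 1) → ℝ) := by
        refine measurable_pi_iff.2 fun i => ?_
        refine Fin.cases ?_ (fun i => ?_) i <;> simp <;> fun_prop
      have hm' : Measurable fun t : ℝ => ENNReal.ofReal (fieldDensity W η (Fin.cons t y)) :=
        (hm.comp hc).ennreal_ofReal
      simp only
      rw [← (mulHaar_mul (half_pos (hg y hy))).lintegral_comp hm',
        ← mulHaar_inv.lintegral_comp (by fun_prop)]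
    rw [h1, lintegral_lintegral_swap]
    swap
    · have hc : Measurable fun p : (Fin n → ℝ) × ℝ =>
          (Fin.cons (((∑ i, W 0 i.succ * p.1 i) + η 0) / 2 * p.2⁻¹) p.1 : Fin (n + 1) → ℝ) := by
        refine measurable_pi_iff.2 fun i => ?_
        refine Fin.cases ?_ (fun i => ?_) i <;> simp <;> fun_prop
      exact (hm.comp hc).ennreal_ofReal.aemeasurable
    set A := ∑ i : Fin n, W 0 i.succ with hA
    set K := √2 * √(2 * π) ^ n *
      Real.exp (-(∑ i : Fin n, ∑ j : Fin n, W i.succ j.succ) / 2 - (∑ i : Fin n, η i.succ)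
        - W 0 0 / 2) with hK
    have hK0 : 0 ≤ K := by positivity
    have hc0 : 0 < A + η 0 := by simpa using hg (fun _ => 1) fun _ => one_pos
    have h2 : ∀ b, 0 < b → ∫⁻ y, ENNReal.ofReal (fieldDensity W η
          (Fin.cons (((∑ i, W 0 i.succ * y i) + η 0) / 2 * b⁻¹) y)) ∂piHaar (Fin n) =
        ENNReal.ofReal K * ENNReal.ofReal (√b * Real.exp (-b - (A + η 0) ^ 2 / (4 * b))) := by
      intro b hb
      have hs : 0 < 1 / (2 * b) := by positivity
      have hm2 := measurable_fieldDensity (elimW W (1 / (2 * b))) (elimEta W η (1 / (2 * b)))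
      calc _ = ∫⁻ y, ENNReal.ofReal (√2 * √b * Real.exp (-b - η 0 ^ 2 / (4 * b) - W 0 0 / 2)) *
            ENNReal.ofReal (fieldDensity (elimW W (1 / (2 * b))) (elimEta W η (1 / (2 * b))) y)
            ∂piHaar (Fin n) := by
            refine lintegral_congr_ae ((ae_piHaar_pos _).mono fun y hy => ?_)
            simp only
            rw [fieldDensity_cons hW η hb rfl (hg y hy), ENNReal.ofReal_mul (by positivity)]
        _ = _ := by
            rw [lintegral_const_mul _ (by fun_prop), ih, ← ENNReal.ofReal_mul (by positivity),
              ← ENNReal.ofReal_mul hK0]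
            rotate_left
            · intro i j
              simp only [elimW]
              rw [hW i.succ]
              ring
            · intro i j
              have := hW0 i.succ j.succ
              have := hW0 0 i.succ
              have := hW0 0 j.succ
              simp only [elimW]
              positivity
            · intro i
              have := hη0 i.succ
              have := hη0 0
              have := hW0 0 i.succ
              simp only [elimEta]
              positivity
            · exact hG.elim hW hW0 hη0 hs
            congr 1
            have e1 : ∑ i, ∑ j, elimW W (1 / (2 * b)) i j =
                (∑ i : Fin n, ∑ j : Fin n, W i.succ j.succ) + 1 / (2 * b) * A ^ 2 := by
              simp only [elimW, Finset.sum_add_distrib, ← Finset.mul_sum, ← Finset.sum_mul, hA, sq]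
            have e2 : ∑ i, elimEta W η (1 / (2 * b)) i =
                (∑ i : Fin n, η i.succ) + 1 / (2 * b) * (η 0 * A) := by
              simp only [elimEta, Finset.sum_add_distrib, ← Finset.mul_sum, hA]
            rw [e1, e2, hK]
            have e3 : ∀ p q t r u : ℝ, p * q * Real.exp r * (t * Real.exp u) =
              p * q * t * Real.exp (r + u) := fun p q t r u => by rw [Real.exp_add]; ring
            rw [e3, e3, mul_right_comm √2]
            congr 2
            field_simp
            ring
    rw [lintegral_congr_ae (ae_mulHaar_pos.mono h2), lintegral_const_mul _ (by fun_prop),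
      lintegral_inverseGaussian hc0, ← ENNReal.ofReal_mul hK0]
    congr 1
    have e1 : ∑ i, ∑ j, W i j = W 0 0 + 2 * A + ∑ i : Fin n, ∑ j : Fin n, W i.succ j.succ := by
      rw [Fin.sum_univ_succ, Fin.sum_univ_succ]
      simp only [Fin.sum_univ_succ (f := W (Fin.succ _)), Finset.sum_add_distrib, hW (Fin.succ _) 0]
      rw [← hA]
      ring
    rw [e1, Fin.sum_univ_succ (f := η), hK, pow_succ, Real.sqrt_mul zero_le_two π]
    have e4 : ∀ p t r q u : ℝ, p * t * Real.exp r * (q * Real.exp u) =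
      t * (p * q) * Real.exp (r + u) := fun p t r q u => by rw [Real.exp_add]; ring
    rw [e4]
    congr 2
    ring

lemma Grounded.comp_equiv {ι κ : Type*} {W : ι → ι → ℝ} {η : ι → ℝ} (h : Grounded W η)
    (e : κ ≃ ι) : Grounded (fun i j => W (e i) (e j)) (fun i => η (e i)) := by
  intro S hS
  obtain ⟨_, ⟨i, hi, rfl⟩, hi' | ⟨j, hj, hij⟩⟩ := h (e '' S) (hS.image _)
  · exact ⟨i, hi, .inl hi'⟩
  · refine ⟨i, hi, .inr ⟨e.symm j, fun h => hj ⟨_, h, e.apply_symm_apply j⟩, ?_⟩⟩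
    simpa using hij

lemma fieldDensity_comp_equiv {ι κ : Type*} [Fintype ι] [DecidableEq ι] [Fintype κ]
    [DecidableEq κ] (e : κ ≃ ι) (W : ι → ι → ℝ) (η y : ι → ℝ) :
    fieldDensity (fun i j => W (e i) (e j)) (fun i => η (e i)) (fun i => y (e i)) =
      fieldDensity W η y := by
  have hsum : ∀ f : ι → ℝ, ∑ k, f (e k) = ∑ k, f k := fun f => e.sum_comp f
  have hdet : (groundedLap (fun i j => W (e i) (e j)) (fun i => η (e i)) fun i => y (e i)).det =
      (groundedLap W η y).det := by
    rw [← Matrix.det_submatrix_equiv_self e]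
    congr 1
    ext i j
    simp only [groundedLap, Matrix.of_apply, Matrix.submatrix_apply, e.injective.eq_iff]
    rw [hsum fun k => W (e i) k * y k]
  unfold fieldDensity
  rw [hdet, e.prod_comp fun i => (y i)⁻¹, hsum fun i => η i * y i]
  have hsum' : ∀ i, ∑ k, W (e i) (e k) * y (e k) = ∑ k, W (e i) k * y k := fun i =>
    hsum fun k => W (e i) k * y k
  simp only [hsum']
  rw [hsum fun i => ((∑ k, W i k * y k) + η i) / y i]

lemma lintegral_fieldDensity {ι : Type*} [Fintype ι] [DecidableEq ι] {W : ι → ι → ℝ} {η : ι → ℝ}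
    (hW : ∀ i j, W i j = W j i) (hW0 : ∀ i j, 0 ≤ W i j) (hη0 : ∀ i, 0 ≤ η i)
    (hG : Grounded W η) :
    ∫⁻ y, ENNReal.ofReal (fieldDensity W η y) ∂piHaar ι =
      ENNReal.ofReal (√(2 * π) ^ Fintype.card ι *
        Real.exp (-(∑ i, ∑ j, W i j) / 2 - ∑ i, η i)) := by
  let e := (Fintype.equivFin ι).symm
  have h := lintegral_fieldDensity_fin (W := fun i j => W (e i) (e j)) (η := fun i => η (e i))
    (fun _ _ => hW _ _) (fun _ _ => hW0 _ _) (fun _ => hη0 _) (hG.comp_equiv e)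
  have hsum : ∀ f : ι → ℝ, ∑ k, f (e k) = ∑ k, f k := fun f => e.sum_comp f
  rw [hsum η] at h
  have hsum' : ∀ i, ∑ k, W (e i) (e k) = ∑ k, W (e i) k := fun i => hsum (W (e i))
  simp only [hsum'] at h
  rw [hsum fun i => ∑ k, W i k] at h
  rw [← h, lintegral_piHaar_equiv e.symm]
  refine lintegral_congr fun y => ?_
  rw [← fieldDensity_comp_equiv e W η]
  rfl

/-- A choice of a successor for each vertex other than `x` is descending if some height function
decreases along it, that is, if following it always leads to `x`. -/
def Descending {x : V} (f : {v : V // v ≠ x} → V) : Prop :=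
  ∃ d : V → ℕ, ∀ i : {v : V // v ≠ x}, d (f i) < d i

lemma det_one_sub_of_descending {x : V} {f : {v : V // v ≠ x} → V} (hf : Descending f) :
    (Matrix.of fun i j : {v : V // v ≠ x} =>
      ((if i = j then 1 else 0) - if f i = j then 1 else 0 : ℝ)).det = 1 := by
  obtain ⟨d, hd⟩ := hf
  set M := Matrix.of fun i j : {v : V // v ≠ x} =>
      ((if i = j then 1 else 0) - if f i = j then 1 else 0 : ℝ) with hM
  have hne : ∀ i j : {v : V // v ≠ x}, d i ≤ d j → f i ≠ j := fun i j h h' => by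
    have := hd i
    rw [h'] at this
    omega
  have ht : M.BlockTriangular fun i => OrderDual.toDual (d i) := by
    intro i j hij
    have hij : d i < d j := hij
    have h1 : i ≠ j := by rintro rfl; exact lt_irrefl _ hij
    simp [hM, h1, hne i j hij.le]
  rw [ht.det]
  refine Finset.prod_eq_one fun a _ => ?_
  have : M.toSquareBlock (fun i => OrderDual.toDual (d i)) a = 1 := by
    ext ⟨i, hi⟩ ⟨j, hj⟩
    have h : d i = d j := OrderDual.toDual.injective (hi.trans hj.symm)
    simp [hM, Matrix.toSquareBlock, Matrix.toSquareBlockProp, Matrix.one_apply, hne i j h.le]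
  rw [this, Matrix.det_one]

lemma det_one_sub_of_not_descending {x : V} {f : {v : V // v ≠ x} → V} (hf : ¬ Descending f) :
    (Matrix.of fun i j : {v : V // v ≠ x} =>
      ((if i = j then 1 else 0) - if f i = j then 1 else 0 : ℝ)).det = 0 := by
  let F : V → V := fun v => if h : v ≠ x then f ⟨v, h⟩ else x
  have hF : ∀ i : {v : V // v ≠ x}, F i = f i := fun i => by simp [F, i.2]
  have hFx : F x = x := by simp [F]
  let R : V → Prop := fun v => ∃ n, F^[n] v = x
  have hR : ∀ v, R (F v) ↔ R v := by
    refine fun v => ⟨fun ⟨n, hn⟩ => ⟨n + 1, by simpa using hn⟩, fun ⟨n, hn⟩ => ⟨n, ?_⟩⟩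
    rw [← Function.iterate_succ_apply, Function.iterate_succ_apply', hn, hFx]
  have hex : ∃ v, ¬ R v := by
    by_contra! h
    refine hf ⟨fun v => Nat.find (h v), fun i => ?_⟩
    have h1 := Nat.find_spec (h i)
    have h0 : Nat.find (h i) ≠ 0 := fun h0 => by
      rw [h0] at h1
      exact i.2 h1
    obtain ⟨n, hn⟩ := Nat.exists_eq_succ_of_ne_zero h0
    rw [hn, Function.iterate_succ_apply, hF] at h1
    change Nat.find (h (f i)) < Nat.find (h i)
    exact (Nat.find_min' (h (f i)) h1).trans_lt (by omega)
  obtain ⟨v, hv⟩ := hex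
  have hvx : v ≠ x := by
    rintro rfl
    exact hv ⟨0, rfl⟩
  refine Matrix.exists_mulVec_eq_zero_iff.1
    ⟨fun i => if R i then 0 else 1, fun h => ?_, ?_⟩
  · have := congrFun h ⟨v, hvx⟩
    simp [hv] at this
  · ext i
    have hRi := hR i
    rw [hF] at hRi
    simp only [Matrix.mulVec, dotProduct, Matrix.of_apply, sub_mul, ite_mul, one_mul, zero_mul,
      Finset.sum_sub_distrib, Finset.sum_ite_eq, Finset.mem_univ, if_true, Pi.zero_apply]
    by_cases hx : f i = x
    · have h2 : R i := hRi.1 (hx ▸ ⟨0, rfl⟩)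
      rw [Finset.sum_eq_zero fun j _ => if_neg fun h => j.2 (h.symm.trans hx)]
      simp [h2]
    · rw [Finset.sum_eq_single ⟨f i, hx⟩]
      · simp [hRi]
      · intro j _ hj
        exact if_neg fun h => hj (Subtype.ext h.symm)
      · simp

/-- The edge set traced by a choice of successors. -/
def succEdges {x : V} (f : {v : V // v ≠ x} → V) : Finset (Sym2 V) :=
  Finset.univ.image fun i : {v : V // v ≠ x} => s((i : V), f i)

lemma Descending.injective_edge {x : V} {f : {v : V // v ≠ x} → V} (hf : Descending f) :
    Function.Injective fun i : {v : V // v ≠ x} => s((i : V), f i) := by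
  obtain ⟨d, hd⟩ := hf
  intro i j h
  rcases Sym2.eq_iff.1 h with ⟨h1, -⟩ | ⟨h1, h2⟩
  · exact Subtype.ext h1
  · have hi := hd i
    have hj := hd j
    rw [h2] at hi
    rw [← h1] at hj
    omega

lemma Descending.card_succEdges {x : V} {f : {v : V // v ≠ x} → V} (hf : Descending f) :
    (succEdges f).card + 1 = Fintype.card V := by
  rw [succEdges, Finset.card_image_of_injective _ hf.injective_edge, Finset.card_univ,
    Fintype.card_subtype_compl, Fintype.card_subtype_eq]
  have := Fintype.card_pos_iff.2 ⟨x⟩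
  omega

lemma nat_card_edgeSet_fromEdgeSet {G : SimpleGraph V} [DecidableRel G.Adj] {F : Finset (Sym2 V)}
    (hF : F ⊆ G.edgeFinset) :
    Nat.card (SimpleGraph.fromEdgeSet (F : Set (Sym2 V))).edgeSet = F.card := by
  have : (SimpleGraph.fromEdgeSet (F : Set (Sym2 V))).edgeSet = F := by
    rw [SimpleGraph.edgeSet_fromEdgeSet]
    refine sdiff_eq_left.2 (Set.disjoint_left.2 fun e he hd => ?_)
    exact G.not_isDiag_of_mem_edgeSet (SimpleGraph.mem_edgeFinset.1 (hF he)) hd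
  rw [this]
  simp

lemma Descending.succEdges_mem {G : SimpleGraph V} [DecidableRel G.Adj] {x : V}
    {f : {v : V // v ≠ x} → V} (hf : Descending f) (hG : ∀ i : {v : V // v ≠ x}, G.Adj i (f i)) :
    succEdges f ∈ spanningTrees G := by
  have hsub : succEdges f ⊆ G.edgeFinset := by
    intro e he
    obtain ⟨i, -, rfl⟩ := Finset.mem_image.1 he
    exact SimpleGraph.mem_edgeFinset.2 (hG i)
  refine Finset.mem_filter.2 ⟨Finset.mem_powerset.2 hsub, ?_⟩
  rw [SimpleGraph.isTree_iff_connected_and_card, nat_card_edgeSet_fromEdgeSet hsub,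
    hf.card_succEdges, Nat.card_eq_fintype_card]
  refine ⟨?_, rfl⟩
  obtain ⟨d, hd⟩ := hf
  have key : ∀ n v, d v < n →
      (SimpleGraph.fromEdgeSet (succEdges f : Set (Sym2 V))).Reachable v x := by
    intro n
    induction n with
    | zero => intro v h; omega
    | succ n ih =>
      intro v h
      by_cases hv : v = x
      · rw [hv]
      · have h1 := hd ⟨v, hv⟩
        refine SimpleGraph.Reachable.trans (SimpleGraph.Adj.reachable ?_)
          (ih (f ⟨v, hv⟩) (by simp only at h1; omega))
        refine (SimpleGraph.fromEdgeSet_adj _).2 ⟨?_, (hG ⟨v, hv⟩).ne⟩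
        exact Finset.mem_coe.2 (Finset.mem_image.2 ⟨⟨v, hv⟩, Finset.mem_univ _, rfl⟩)
  exact SimpleGraph.connected_iff_exists_forall_reachable _ |>.2
    ⟨x, fun v => (key _ v (Nat.lt_succ_self _)).symm⟩

lemma Descending.eq_of_succEdges_eq {x : V} {f g : {v : V // v ≠ x} → V} (hf : Descending f)
    (h : succEdges f = succEdges g) : f = g := by
  obtain ⟨d, hd⟩ := hf
  have key : ∀ n (i : {v : V // v ≠ x}), d i < n → f i = g i := by
    intro n
    induction n with
    | zero => intro i h; omega
    | succ n ih =>
      intro i hi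
      have hmem : s((i : V), f i) ∈ succEdges g :=
        h ▸ Finset.mem_image_of_mem _ (Finset.mem_univ i)
      obtain ⟨k, -, hk⟩ := Finset.mem_image.1 hmem
      rcases Sym2.eq_iff.1 hk with ⟨h1, h2⟩ | ⟨h1, h2⟩
      · rw [← h2, Subtype.ext h1]
      · have h3 := hd i
        have h4 := hd k
        rw [← h1] at h3
        rw [ih k (by omega), h2] at h4
        omega
  exact funext fun i => key _ i (Nat.lt_succ_self _)

lemma exists_descending_of_mem_spanningTrees {G : SimpleGraph V} [DecidableRel G.Adj] (x : V)
    {F : Finset (Sym2 V)} (hF : F ∈ spanningTrees G) :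
    ∃ f : {v : V // v ≠ x} → V, Descending f ∧ (∀ i : {v : V // v ≠ x}, G.Adj i (f i)) ∧
      succEdges f = F := by
  obtain ⟨hsub, hT⟩ := Finset.mem_filter.1 hF
  rw [Finset.mem_powerset] at hsub
  set T := SimpleGraph.fromEdgeSet (F : Set (Sym2 V)) with hTdef
  have hstep : ∀ i : {v : V // v ≠ x}, ∃ u, T.Adj i u ∧ T.dist u x < T.dist i x := by
    rintro ⟨i, hi⟩
    obtain ⟨p, hp⟩ := (hT.connected.preconnected i x).exists_walk_length_eq_dist
    cases p with
    | nil => exact absurd rfl hi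
    | cons h q =>
      refine ⟨_, h, ?_⟩
      rw [← hp, SimpleGraph.Walk.length_cons]
      exact Nat.lt_succ_of_le (SimpleGraph.dist_le q)
  choose f hf using hstep
  have hdesc : Descending f := ⟨fun v => T.dist v x, fun i => (hf i).2⟩
  have hmem : ∀ i : {v : V // v ≠ x}, s((i : V), f i) ∈ F := fun i =>
    ((SimpleGraph.fromEdgeSet_adj _).1 (hf i).1).1
  refine ⟨f, hdesc, fun i => SimpleGraph.mem_edgeFinset.1 (hsub (hmem i)), ?_⟩
  refine Finset.eq_of_subset_of_card_le (fun e he => ?_) ?_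
  · obtain ⟨i, -, rfl⟩ := Finset.mem_image.1 he
    exact hmem i
  · have h1 := (SimpleGraph.isTree_iff_connected_and_card.1 hT).2
    rw [nat_card_edgeSet_fromEdgeSet hsub, Nat.card_eq_fintype_card] at h1
    have := hdesc.card_succEdges
    omega

/-- **Matrix-tree theorem** for the Laplacian reduced at `x`. -/
theorem det_reducedLaplacian (G : SimpleGraph V) [DecidableRel G.Adj] (x : V)
    (w : Sym2 V → ℝ) :
    (Matrix.of fun i j : {v : V // v ≠ x} => ((if i = j then vw G w i else 0) -
      if G.Adj i j then w s((i : V), j) else 0)).det = tau G w := by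
  let c : V → V → ℝ := fun i j => if G.Adj i j then w s(i, j) else 0
  let E : {v : V // v ≠ x} → V → {v : V // v ≠ x} → ℝ := fun i u j =>
    (if i = j then 1 else 0) - if u = j then 1 else 0
  have hrow : (Matrix.of fun i j : {v : V // v ≠ x} => ((if i = j then vw G w i else 0) -
      if G.Adj i j then w s((i : V), j) else 0)) =
        fun i : {v : V // v ≠ x} => ∑ u : V, c i u • E i u := by
    ext i j
    simp only [Matrix.of_apply, Finset.sum_apply, Pi.smul_apply, smul_eq_mul, E, mul_sub,
      Finset.sum_sub_distrib, mul_ite, mul_one, mul_zero, Finset.sum_ite_eq', Finset.mem_univ,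
      if_true]
    congr 1
    by_cases hij : i = j
    · subst hij
      simp only [if_true, c, vw]
      rw [← Finset.sum_filter]
      congr 1
      ext
      simp
    · simp [hij]
  have hdet : (Matrix.of fun i j : {v : V // v ≠ x} => ((if i = j then vw G w i else 0) -
      if G.Adj i j then w s((i : V), j) else 0)).det =
      ∑ f : {v : V // v ≠ x} → V, (∏ i : {v : V // v ≠ x}, c i (f i)) *
        (Matrix.of fun i j : {v : V // v ≠ x} =>
        ((if i = j then 1 else 0) - if f i = j then 1 else 0 : ℝ)).det := by
    rw [hrow]
    have h := (Matrix.detRowAlternating (n := {v : V // v ≠ x}) (R := ℝ)).toMultilinearMap.map_sum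
      fun (i : {v : V // v ≠ x}) (u : V) => c i u • E i u
    refine h.trans (Finset.sum_congr rfl fun f _ => ?_)
    exact ((Matrix.detRowAlternating
      (n := {v : V // v ≠ x}) (R := ℝ)).toMultilinearMap.map_smul_univ
      (fun i : {v : V // v ≠ x} => c i (f i)) fun i => E i (f i))
  have hnz : ∀ f : {v : V // v ≠ x} → V, (∏ i : {v : V // v ≠ x}, c i (f i)) *
        (Matrix.of fun i j : {v : V // v ≠ x} =>
        ((if i = j then 1 else 0) - if f i = j then 1 else 0 : ℝ)).det =
      if Descending f ∧ ∀ i : {v : V // v ≠ x}, G.Adj i (f i) then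
        ∏ i : {v : V // v ≠ x}, w s((i : V), f i) else 0 := by
    intro f
    by_cases hf : Descending f
    · rw [det_one_sub_of_descending hf, mul_one]
      by_cases ha : ∀ i : {v : V // v ≠ x}, G.Adj i (f i)
      · simp only [hf, ha, c, if_true, implies_true, and_self]
      · rw [if_neg fun h => ha h.2]
        push Not at ha
        obtain ⟨i, hi⟩ := ha
        exact Finset.prod_eq_zero (Finset.mem_univ i) (if_neg hi)
    · rw [det_one_sub_of_not_descending hf, mul_zero, if_neg fun h => hf h.1]
  rw [hdet, Finset.sum_congr rfl fun f _ => hnz f, ← Finset.sum_filter]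
  refine Finset.sum_bij (fun f _ => succEdges f) ?_ ?_ ?_ ?_
  · intro f hf
    exact (Finset.mem_filter.1 hf).2.1.succEdges_mem (Finset.mem_filter.1 hf).2.2
  · intro f hf g _ h
    exact (Finset.mem_filter.1 hf).2.1.eq_of_succEdges_eq h
  · intro F hF
    obtain ⟨f, h1, h2, h3⟩ := exists_descending_of_mem_spanningTrees x hF
    exact ⟨f, Finset.mem_filter.2 ⟨Finset.mem_univ _, h1, h2⟩, h3⟩
  · intro f hf
    rw [succEdges, Finset.prod_image ((Finset.mem_filter.1 hf).2.1.injective_edge.injOn)]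

lemma sum_neighborFinset_eq_sum_edgeFinset (G : SimpleGraph V) [DecidableRel G.Adj]
    (f : V → V → ℝ) : ∑ i, ∑ j ∈ G.neighborFinset i, f i j =
      ∑ e ∈ G.edgeFinset,
        Sym2.lift ⟨fun i j => f i j + f j i, fun i j => add_comm (f i j) (f j i)⟩ e := by
  have h1 : ∑ i, ∑ j ∈ G.neighborFinset i, f i j =
      ∑ p ∈ Finset.univ.filter (fun p : V × V => G.Adj p.1 p.2), f p.1 p.2 := by
    rw [Finset.sum_filter, Fintype.sum_prod_type]
    refine Finset.sum_congr rfl fun i _ => ?_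
    rw [← Finset.sum_filter]
    refine Finset.sum_congr ?_ fun _ _ => rfl
    ext j
    simp
  have h2 : ∀ p ∈ Finset.univ.filter (fun p : V × V => G.Adj p.1 p.2),
      s(p.1, p.2) ∈ G.edgeFinset := fun p hp =>
    SimpleGraph.mem_edgeFinset.2 (Finset.mem_filter.1 hp).2
  rw [h1, ← Finset.sum_fiberwise_of_maps_to h2]
  refine Finset.sum_congr rfl fun e he => ?_
  induction e with | _ i j
  have hij : G.Adj i j := SimpleGraph.mem_edgeFinset.1 he
  have : (Finset.univ.filter fun p : V × V => G.Adj p.1 p.2).filter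
      (fun p => s(p.1, p.2) = s(i, j)) = {(i, j), (j, i)} := by
    ext ⟨k, l⟩
    simp only [Finset.mem_filter, Finset.mem_univ, true_and, Sym2.eq_iff, Finset.mem_insert,
      Finset.mem_singleton, Prod.mk.injEq, and_iff_right_iff_imp]
    rintro (⟨rfl, rfl⟩ | ⟨rfl, rfl⟩)
    exacts [hij, hij.symm]
  rw [this, Finset.sum_pair (by simp [hij.ne])]
  rfl

lemma sum_mul_vw (G : SimpleGraph V) [DecidableRel G.Adj] (ψ : V → ℝ) (B : Sym2 V → ℝ) :
    ∑ i, ψ i * vw G B i = ∑ e ∈ G.edgeFinset, B e * ssum ψ e := by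
  simp only [vw, Finset.mul_sum]
  rw [sum_neighborFinset_eq_sum_edgeFinset G fun i j => ψ i * B s(i, j)]
  refine Finset.sum_congr rfl fun e _ => ?_
  induction e with | _ i j
  simp only [Sym2.lift_mk, ssum, Sym2.eq_swap (a := j)]
  ring

lemma sum_vw (G : SimpleGraph V) [DecidableRel G.Adj] (B : Sym2 V → ℝ) :
    ∑ i, vw G B i = 2 * ∑ e ∈ G.edgeFinset, B e := by
  have h := sum_mul_vw G (fun _ => 1) B
  simp only [one_mul] at h
  rw [h, Finset.mul_sum]
  refine Finset.sum_congr rfl fun e _ => ?_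
  induction e with | _ i j
  simp only [ssum, Sym2.lift_mk]
  ring

lemma sprod_pos {Y : V → ℝ} (hY : ∀ v, 0 < Y v) (e : Sym2 V) : 0 < sprod Y e := by
  induction e with | _ i j
  exact mul_pos (hY i) (hY j)

lemma prod_sprod_rpow (G : SimpleGraph V) [DecidableRel G.Adj] {Y : V → ℝ} (hY : ∀ v, 0 < Y v)
    (B : Sym2 V → ℝ) :
    ∏ e ∈ G.edgeFinset, sprod Y e ^ B e = ∏ v, Y v ^ vw G B v := by
  have h1 : ∀ e, sprod Y e ^ B e = Real.exp (B e * ssum (fun v => Real.log (Y v)) e) := by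
    intro e
    rw [Real.rpow_def_of_pos (sprod_pos hY e), mul_comm]
    congr 2
    induction e with | _ i j
    simp only [sprod, ssum, Sym2.lift_mk]
    rw [Real.log_mul (hY i).ne' (hY j).ne']
  simp only [h1, ← Real.exp_sum, ← sum_mul_vw]
  rw [Real.exp_sum]
  exact Finset.prod_congr rfl fun v _ => (Real.rpow_def_of_pos (hY v) _).symm

lemma vw_pos {G : SimpleGraph V} [DecidableRel G.Adj] (hd : ∀ v, ∃ u, G.Adj v u)
    {w : Sym2 V → ℝ} (hw : ∀ e ∈ G.edgeFinset, 0 < w e) (v : V) : 0 < vw G w v := by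
  obtain ⟨u, hu⟩ := hd v
  exact Finset.sum_pos (fun j hj => hw _ (SimpleGraph.mem_edgeFinset.2
    ((G.mem_neighborFinset _ _).1 hj))) ⟨u, (G.mem_neighborFinset _ _).2 hu⟩

lemma bwt_pos {G : SimpleGraph V} [DecidableRel G.Adj] (hd : ∀ v, ∃ u, G.Adj v u)
    {B : Sym2 V → ℝ} (hB : ∀ e ∈ G.edgeFinset, 0 < B e) (x v : V) : 0 < bwt G x B v := by
  have := vw_pos hd hB v
  unfold bwt
  split_ifs <;> linarith

lemma sum_bwt (G : SimpleGraph V) [DecidableRel G.Adj] (x : V) (B : Sym2 V → ℝ) :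
    ∑ v, bwt G x B v = (∑ e ∈ G.edgeFinset, B e) + ((Fintype.card V : ℝ) - 1) / 2 := by
  simp only [bwt]
  rw [← Finset.sum_div, Finset.sum_sub_distrib, Finset.sum_add_distrib, sum_vw]
  simp
  ring

lemma tau_smul (G : SimpleGraph V) [DecidableRel G.Adj] (t : ℝ) (w : Sym2 V → ℝ) :
    tau G (fun e => t * w e) = t ^ (Fintype.card V - 1) * tau G w := by
  simp only [tau, Finset.mul_sum]
  refine Finset.sum_congr rfl fun F hF => ?_
  obtain ⟨hsub, hT⟩ := Finset.mem_filter.1 hF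
  have h := (SimpleGraph.isTree_iff_connected_and_card.1 hT).2
  rw [nat_card_edgeSet_fromEdgeSet (Finset.mem_powerset.1 hsub), Nat.card_eq_fintype_card] at h
  rw [Finset.prod_mul_distrib, Finset.prod_const, ← h, Nat.add_sub_cancel]

lemma vw_smul (G : SimpleGraph V) [DecidableRel G.Adj] (t : ℝ) (w : Sym2 V → ℝ) (v : V) :
    vw G (fun e => t * w e) v = t * vw G w v := by
  simp only [vw, Finset.mul_sum]

/-- The unnormalized magic density with respect to the multiplicative Haar measure. -/
def haarDensity (G : SimpleGraph V) [DecidableRel G.Adj] (x : V) (B w : Sym2 V → ℝ) : ℝ :=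
  (∏ e ∈ G.edgeFinset, w e ^ B e) * √(tau G w) * ∏ v, vw G w v ^ (-bwt G x B v)

lemma magicDensity_eq {G : SimpleGraph V} [DecidableRel G.Adj] (hd : ∀ v, ∃ u, G.Adj v u)
    (x : V) (B : Sym2 V → ℝ) {w : Sym2 V → ℝ} (hw : ∀ e ∈ G.edgeFinset, 0 < w e) :
    (∏ e ∈ G.edgeFinset, w e) * magicDensity G x B w =
      (Znorm G x B)⁻¹ * haarDensity G x B w := by
  have h1 : ∏ e ∈ G.edgeFinset, w e ^ B e =
      (∏ e ∈ G.edgeFinset, w e) * ∏ e ∈ G.edgeFinset, w e ^ (B e - 1) := by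
    rw [← Finset.prod_mul_distrib]
    refine Finset.prod_congr rfl fun e he => ?_
    rw [Real.rpow_sub_one (hw e he).ne']
    field_simp [(hw e he).ne']
  have h2 : ∏ v, vw G w v ^ (-bwt G x B v) =
      vw G w x ^ ((1 : ℝ) / 2) / ∏ v, vw G w v ^ ((vw G B v + 1) / 2) := by
    have : vw G w x ^ ((1 : ℝ) / 2) =
        ∏ v, if v = x then vw G w v ^ ((1 : ℝ) / 2) else 1 := by simp
    rw [this, ← Finset.prod_div_distrib]
    refine Finset.prod_congr rfl fun v _ => ?_
    have hv := vw_pos hd hw v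
    unfold bwt
    split_ifs
    · rw [← Real.rpow_sub hv]; congr 1; ring
    · rw [one_div, ← Real.rpow_neg hv.le]; congr 1; ring
  rw [magicDensity, haarDensity, h1, h2]
  ring

lemma haarDensity_smul {G : SimpleGraph V} [DecidableRel G.Adj] (hd : ∀ v, ∃ u, G.Adj v u)
    (x : V) (B : Sym2 V → ℝ) {w : Sym2 V → ℝ} (hw : ∀ e ∈ G.edgeFinset, 0 < w e) {t : ℝ}
    (ht : 0 < t) : haarDensity G x B (fun e => t * w e) = haarDensity G x B w := by
  unfold haarDensity
  have h1 : ∏ e ∈ G.edgeFinset, (t * w e) ^ B e =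
      t ^ (∑ e ∈ G.edgeFinset, B e) * ∏ e ∈ G.edgeFinset, w e ^ B e := by
    rw [Real.rpow_sum_of_pos ht, ← Finset.prod_mul_distrib]
    exact Finset.prod_congr rfl fun e he => Real.mul_rpow ht.le (hw e he).le
  have h2 : ∏ v, vw G (fun e => t * w e) v ^ (-bwt G x B v) =
      t ^ (-((∑ e ∈ G.edgeFinset, B e) + ((Fintype.card V : ℝ) - 1) / 2)) *
        ∏ v, vw G w v ^ (-bwt G x B v) := by
    rw [← sum_bwt G x, ← Finset.sum_neg_distrib, Real.rpow_sum_of_pos ht, ← Finset.prod_mul_distrib]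
    refine Finset.prod_congr rfl fun v _ => ?_
    rw [vw_smul, Real.mul_rpow ht.le (vw_pos hd hw v).le]
  have hn : 1 ≤ Fintype.card V := Fintype.card_pos_iff.2 ⟨x⟩
  have h3 : √(t ^ (Fintype.card V - 1)) = t ^ (((Fintype.card V : ℝ) - 1) / 2) := by
    rw [Real.sqrt_eq_rpow, ← Real.rpow_natCast, ← Real.rpow_mul ht.le]
    congr 1
    push_cast [hn]
    ring
  rw [h1, h2, tau_smul, Real.sqrt_mul (by positivity), h3]
  have h4 : t ^ (∑ e ∈ G.edgeFinset, B e) * t ^ (((Fintype.card V : ℝ) - 1) / 2) *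
      t ^ (-((∑ e ∈ G.edgeFinset, B e) + ((Fintype.card V : ℝ) - 1) / 2)) = 1 := by
    rw [← Real.rpow_add ht, ← Real.rpow_add ht, add_neg_cancel, Real.rpow_zero]
  linear_combination ((∏ e ∈ G.edgeFinset, w e ^ B e) * √(tau G w) *
    ∏ v, vw G w v ^ (-bwt G x B v)) * h4

/-- The density of the environment jointly with an auxiliary positive field `y` off the root. -/
def jointDensity (G : SimpleGraph V) [DecidableRel G.Adj] (x : V) (B w : Sym2 V → ℝ)
    (y : {v : V // v ≠ x} → ℝ) : ℝ :=
  (∏ e ∈ G.edgeFinset, w e ^ B e) * √(tau G w) * Real.exp (-(vw G w x / 2)) *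
    ∏ v : {v : V // v ≠ x}, (y v ^ (-(2 * bwt G x B v)) * Real.exp (-(vw G w v / 2 / y v ^ 2)))

lemma prod_subtype_ne_mul {M : Type*} [CommMonoid M] (f : V → M) (x : V) :
    f x * ∏ v : {v : V // v ≠ x}, f v = ∏ v, f v :=
  (Fintype.prod_eq_mul_prod_subtype_ne f x).symm

lemma lintegral_jointDensity {G : SimpleGraph V} [DecidableRel G.Adj] (hd : ∀ v, ∃ u, G.Adj v u)
    (x : V) {B w : Sym2 V → ℝ} (hB : ∀ e ∈ G.edgeFinset, 0 < B e)
    (hw : ∀ e ∈ G.edgeFinset, 0 < w e) :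
    ∫⁻ y, ENNReal.ofReal (jointDensity G x B w y) ∂piHaar {v : V // v ≠ x} =
      ENNReal.ofReal (haarDensity G x B w *
        (∏ v : {v : V // v ≠ x}, (2 ^ bwt G x B v * (1 / 2) * Real.Gamma (bwt G x B v))) *
          (vw G w x ^ bwt G x B x * Real.exp (-(vw G w x / 2)))) := by
  have hA : 0 ≤ (∏ e ∈ G.edgeFinset, w e ^ B e) * √(tau G w) * Real.exp (-(vw G w x / 2)) :=
    mul_nonneg (mul_nonneg (Finset.prod_nonneg fun e he => Real.rpow_nonneg (hw e he).le _)
      (Real.sqrt_nonneg _)) (Real.exp_pos _).le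
  have h1 : ∀ y : {v : V // v ≠ x} → ℝ, (∀ v, 0 < y v) →
      ENNReal.ofReal (jointDensity G x B w y) =
      ENNReal.ofReal ((∏ e ∈ G.edgeFinset, w e ^ B e) * √(tau G w) *
        Real.exp (-(vw G w x / 2))) * ∏ v : {v : V // v ≠ x},
        ENNReal.ofReal (y v ^ (-(2 * bwt G x B v)) * Real.exp (-(vw G w v / 2 / y v ^ 2))) := by
    intro y hy
    rw [jointDensity, ENNReal.ofReal_mul hA, ENNReal.ofReal_prod_of_nonneg]
    intro v _
    have := hy v
    positivity
  have hm : ∀ v : {v : V // v ≠ x}, Measurable fun t : ℝ =>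
      ENNReal.ofReal (t ^ (-(2 * bwt G x B v)) * Real.exp (-(vw G w v / 2 / t ^ 2))) := by
    intro v; fun_prop
  rw [lintegral_congr_ae ((ae_piHaar_pos _).mono h1), lintegral_const_mul _ (by fun_prop),
    piHaar, lintegral_pi_prod mulHaar hm]
  have h2 : ∀ v : {v : V // v ≠ x}, ∫⁻ t, ENNReal.ofReal (t ^ (-(2 * bwt G x B v)) *
      Real.exp (-(vw G w v / 2 / t ^ 2))) ∂mulHaar =
      ENNReal.ofReal (vw G w v ^ (-bwt G x B v) *
        (2 ^ bwt G x B v * (1 / 2) * Real.Gamma (bwt G x B v))) := by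
    intro v
    have hv := vw_pos hd hw v
    rw [lintegral_mulHaar_gamma_sq (bwt_pos hd hB x v) (half_pos hv),
      Real.div_rpow hv.le zero_le_two,
      Real.rpow_neg zero_le_two]
    congr 1
    field_simp
  rw [Finset.prod_congr rfl fun v _ => h2 v, ← ENNReal.ofReal_prod_of_nonneg,
    ← ENNReal.ofReal_mul hA]
  · congr 1
    rw [Finset.prod_mul_distrib, haarDensity, ← prod_subtype_ne_mul _ x]
    have h3 : vw G w x ^ (-bwt G x B x) * vw G w x ^ bwt G x B x = 1 := by
      rw [← Real.rpow_add (vw_pos hd hw x), neg_add_cancel, Real.rpow_zero]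
    linear_combination (-(∏ e ∈ G.edgeFinset, w e ^ B e) * √(tau G w) *
      (∏ v : {v : V // v ≠ x}, vw G w v ^ (-bwt G x B v)) * (∏ v : {v : V // v ≠ x},
        (2 ^ bwt G x B v * (1 / 2) * Real.Gamma (bwt G x B v))) * Real.exp (-(vw G w x / 2))) * h3
  · intro v _
    have hv := vw_pos hd hw v
    have := Real.Gamma_pos_of_pos (bwt_pos hd hB x v)
    positivity

lemma haarDensity_nonneg {G : SimpleGraph V} [DecidableRel G.Adj] (hd : ∀ v, ∃ u, G.Adj v u)
    (x : V) (B : Sym2 V → ℝ) {w : Sym2 V → ℝ} (hw : ∀ e ∈ G.edgeFinset, 0 < w e) :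
    0 ≤ haarDensity G x B w :=
  mul_nonneg (mul_nonneg (Finset.prod_nonneg fun e he => Real.rpow_nonneg (hw e he).le _)
      (Real.sqrt_nonneg _)) (Finset.prod_nonneg fun v _ => Real.rpow_nonneg (vw_pos hd hw v).le _)

lemma lintegral_lintegral_jointDensity {G : SimpleGraph V} [DecidableRel G.Adj]
    (hd : ∀ v, ∃ u, G.Adj v u)
    (x : V) {B w : Sym2 V → ℝ} (hB : ∀ e ∈ G.edgeFinset, 0 < B e)
    (hw : ∀ e ∈ G.edgeFinset, 0 < w e) :
    ∫⁻ t, ∫⁻ y, ENNReal.ofReal (jointDensity G x B (fun e => t * w e) y)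
        ∂piHaar {v : V // v ≠ x} ∂mulHaar =
      ENNReal.ofReal (2 * ∏ v, (2 ^ bwt G x B v * (1 / 2) * Real.Gamma (bwt G x B v))) *
        ENNReal.ofReal (haarDensity G x B w) := by
  have hx := vw_pos hd hw x
  have hbx := bwt_pos hd hB x x
  set C := ∏ v : {v : V // v ≠ x}, (2 ^ bwt G x B v * (1 / 2) * Real.Gamma (bwt G x B v)) with hC
  have hC0 : 0 ≤ C := Finset.prod_nonneg fun v _ => by
    have := Real.Gamma_pos_of_pos (bwt_pos hd hB x v)
    positivity
  have hh := haarDensity_nonneg hd x B hw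
  have hK : 0 ≤ haarDensity G x B w * C * vw G w x ^ bwt G x B x :=
    mul_nonneg (mul_nonneg hh hC0) (Real.rpow_nonneg hx.le _)
  have h1 : ∀ t : ℝ, 0 < t → ∫⁻ y, ENNReal.ofReal (jointDensity G x B (fun e => t * w e) y)
        ∂piHaar {v : V // v ≠ x} =
      ENNReal.ofReal (haarDensity G x B w * C * vw G w x ^ bwt G x B x) *
        ENNReal.ofReal (t ^ bwt G x B x * Real.exp (-(vw G w x / 2 * t))) := by
    intro t ht
    rw [lintegral_jointDensity hd x hB fun e he => mul_pos ht (hw e he),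
      haarDensity_smul hd x B hw ht, vw_smul, Real.mul_rpow ht.le hx.le, ← hC,
      ← ENNReal.ofReal_mul hK]
    congr 1
    rw [show vw G w x / 2 * t = t * vw G w x / 2 by ring]
    ring
  rw [lintegral_congr_ae (ae_mulHaar_pos.mono h1), lintegral_const_mul _ (by fun_prop),
    lintegral_mulHaar_gamma hbx (half_pos hx), ← ENNReal.ofReal_mul hK,
    ← ENNReal.ofReal_mul]
  · congr 1
    rw [← prod_subtype_ne_mul _ x, ← hC, Real.div_rpow hx.le zero_le_two,
      Real.rpow_neg zero_le_two, Real.rpow_neg hx.le]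
    field_simp
  · refine mul_nonneg zero_le_two (Finset.prod_nonneg fun v _ => ?_)
    have := Real.Gamma_pos_of_pos (bwt_pos hd hB x v)
    positivity

/-- The symmetric matrix of conductances. -/
def conductance (G : SimpleGraph V) [DecidableRel G.Adj] (w : Sym2 V → ℝ) (i j : V) : ℝ :=
  if G.Adj i j then w s(i, j) else 0

lemma conductance_comm (G : SimpleGraph V) [DecidableRel G.Adj] (w : Sym2 V → ℝ) (i j : V) :
    conductance G w i j = conductance G w j i := by
  simp only [conductance, G.adj_comm i j, Sym2.eq_swap]

lemma conductance_nonneg {G : SimpleGraph V} [DecidableRel G.Adj] {w : Sym2 V → ℝ}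
    (hw : ∀ e ∈ G.edgeFinset, 0 < w e) (i j : V) : 0 ≤ conductance G w i j := by
  unfold conductance
  split_ifs with h
  exacts [(hw _ (SimpleGraph.mem_edgeFinset.2 h)).le, le_rfl]

lemma sum_conductance (G : SimpleGraph V) [DecidableRel G.Adj] (w : Sym2 V → ℝ) (i : V)
    (f : V → ℝ) : ∑ j, conductance G w i j * f j = ∑ j ∈ G.neighborFinset i, w s(i, j) * f j := by
  simp only [conductance, ite_mul, zero_mul]
  rw [← Finset.sum_filter]
  refine Finset.sum_congr ?_ fun _ _ => rfl
  ext j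
  simp

lemma vw_eq_sum_conductance (G : SimpleGraph V) [DecidableRel G.Adj] (w : Sym2 V → ℝ) (i : V) :
    vw G w i = ∑ j, conductance G w i j := by
  simpa [vw] using (sum_conductance G w i fun _ => 1).symm

/-- The field extended by `1` at the root. -/
def fieldExt (x : V) (y : {v : V // v ≠ x} → ℝ) (v : V) : ℝ :=
  if h : v ≠ x then y ⟨v, h⟩ else 1

lemma fieldExt_root (x : V) (y : {v : V // v ≠ x} → ℝ) : fieldExt x y x = 1 := by simp [fieldExt]

lemma fieldExt_coe (x : V) (y : {v : V // v ≠ x} → ℝ) (v : {v : V // v ≠ x}) :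
    fieldExt x y v = y v := by simp [fieldExt, v.2]

lemma fieldExt_pos {x : V} {y : {v : V // v ≠ x} → ℝ} (hy : ∀ v, 0 < y v) (v : V) :
    0 < fieldExt x y v := by
  unfold fieldExt
  split_ifs
  exacts [hy _, one_pos]

lemma vw_sprod_mul (G : SimpleGraph V) [DecidableRel G.Adj] (w : Sym2 V → ℝ) (x : V)
    (y : {v : V // v ≠ x} → ℝ) (i : V) :
    vw G (fun e => sprod (fieldExt x y) e * w e) i = fieldExt x y i *
      ((∑ k : {v : V // v ≠ x}, conductance G w i k * y k) + conductance G w i x) := by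
  have h1 := Fintype.sum_eq_add_sum_subtype_ne
    (fun j => conductance G w i j * fieldExt x y j) x
  simp only [fieldExt_root, fieldExt_coe, mul_one] at h1
  rw [add_comm, ← h1, sum_conductance, Finset.mul_sum, vw]
  refine Finset.sum_congr rfl fun j _ => ?_
  simp only [sprod, Sym2.lift_mk]
  ring

lemma tau_sprod_mul (G : SimpleGraph V) [DecidableRel G.Adj] (w : Sym2 V → ℝ) (x : V)
    (y : {v : V // v ≠ x} → ℝ) :
    tau G (fun e => sprod (fieldExt x y) e * w e) =
      (groundedLap (fun i j : {v : V // v ≠ x} => conductance G w i j)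
        (fun i => conductance G w i x) y).det := by
  rw [← det_reducedLaplacian G x]
  congr 1
  ext i j
  simp only [Matrix.of_apply, groundedLap, vw_sprod_mul, fieldExt_coe]
  congr 1
  simp only [conductance, sprod, Sym2.lift_mk, fieldExt_coe]
  split_ifs <;> ring

lemma jointDensity_sprod_mul {G : SimpleGraph V} [DecidableRel G.Adj] (x : V) (B : Sym2 V → ℝ)
    {w : Sym2 V → ℝ} (hw : ∀ e ∈ G.edgeFinset, 0 < w e) {y : {v : V // v ≠ x} → ℝ}
    (hy : ∀ v, 0 < y v) :
    jointDensity G x B (fun e => sprod (fieldExt x y) e * w e) y =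
      (∏ e ∈ G.edgeFinset, w e ^ B e) *
        fieldDensity (fun i j : {v : V // v ≠ x} => conductance G w i j)
          (fun i => conductance G w i x) y := by
  have hY := fieldExt_pos hy
  have h1 : ∏ e ∈ G.edgeFinset, (sprod (fieldExt x y) e * w e) ^ B e =
      (∏ e ∈ G.edgeFinset, w e ^ B e) * ∏ v : {v : V // v ≠ x}, y v ^ vw G B v := by
    rw [Finset.prod_congr rfl fun e he => Real.mul_rpow (sprod_pos hY e).le (hw e he).le,
      Finset.prod_mul_distrib, prod_sprod_rpow G hY, ← prod_subtype_ne_mul _ x]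
    simp only [fieldExt_root, fieldExt_coe, Real.one_rpow]
    ring
  have h2 : vw G (fun e => sprod (fieldExt x y) e * w e) x =
      ∑ i : {v : V // v ≠ x}, conductance G w i x * y i := by
    rw [vw_sprod_mul, fieldExt_root, one_mul]
    simp only [conductance_comm G w x]
    simp [conductance]
  have h3 : ∀ v : {v : V // v ≠ x}, y v ^ (-(2 * bwt G x B v)) *
      Real.exp (-(vw G (fun e => sprod (fieldExt x y) e * w e) v / 2 / y v ^ 2)) =
      (y v ^ vw G B v)⁻¹ * (y v)⁻¹ * Real.exp (-(((∑ k : {v : V // v ≠ x},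
        conductance G w v k * y k) + conductance G w v x) / y v) / 2) := by
    intro v
    have hv := hy v
    rw [vw_sprod_mul, fieldExt_coe]
    congr 1
    · rw [← Real.rpow_neg_one (y v), ← Real.rpow_neg hv.le, ← Real.rpow_add hv]
      congr 1
      simp only [bwt, v.2, if_false]
      ring
    · congr 1
      field_simp
  rw [jointDensity, h1, tau_sprod_mul, h2, Finset.prod_congr rfl fun v _ => h3 v,
    Finset.prod_mul_distrib, Finset.prod_mul_distrib, fieldDensity, ← Real.exp_sum,
    ← Finset.sum_div, Finset.sum_neg_distrib, sub_eq_add_neg, Real.exp_add, Finset.prod_inv_distrib]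
  have h4 : ∏ v : {v : V // v ≠ x}, y v ^ vw G B v ≠ 0 :=
    Finset.prod_ne_zero_iff.2 fun v _ => (Real.rpow_pos_of_pos (hy v) _).ne'
  field_simp

/-- Extension of edge coordinates by zero. -/
def edgeExt (G : SimpleGraph V) [DecidableRel G.Adj] (w : {e // e ∈ G.edgeFinset} → ℝ)
    (e : Sym2 V) : ℝ :=
  if h : e ∈ G.edgeFinset then w ⟨e, h⟩ else 0

lemma edgeExt_coe (G : SimpleGraph V) [DecidableRel G.Adj] (w : {e // e ∈ G.edgeFinset} → ℝ)
    (e : {e // e ∈ G.edgeFinset}) : edgeExt G w e = w e := by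
  rw [edgeExt, dif_pos e.2]

lemma edgeExt_pos {G : SimpleGraph V} [DecidableRel G.Adj] {w : {e // e ∈ G.edgeFinset} → ℝ}
    (hw : ∀ e, 0 < w e) (e : Sym2 V) (he : e ∈ G.edgeFinset) : 0 < edgeExt G w e := by
  rw [edgeExt, dif_pos he]
  exact hw _

lemma measurable_edgeExt (G : SimpleGraph V) [DecidableRel G.Adj] : Measurable (edgeExt G) := by
  refine measurable_pi_iff.2 fun e => ?_
  unfold edgeExt
  split_ifs <;> fun_prop

lemma measurable_jointDensity (G : SimpleGraph V) [DecidableRel G.Adj] (x : V) (B : Sym2 V → ℝ) :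
    Measurable fun p : (Sym2 V → ℝ) × ({v : V // v ≠ x} → ℝ) => jointDensity G x B p.1 p.2 := by
  unfold jointDensity tau vw
  fun_prop

lemma measurable_sprod_fieldExt (x : V) (e : Sym2 V) :
    Measurable fun y : {v : V // v ≠ x} → ℝ => sprod (fieldExt x y) e := by
  have h : ∀ v, Measurable fun y : {v : V // v ≠ x} → ℝ => fieldExt x y v := fun v => by
    unfold fieldExt
    split_ifs <;> fun_prop
  induction e with | _ i j
  exact (h i).mul (h j)

lemma grounded_conductance {G : SimpleGraph V} [DecidableRel G.Adj] (hG : G.Connected) (x : V)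
    {w : Sym2 V → ℝ} (hw : ∀ e ∈ G.edgeFinset, 0 < w e) :
    Grounded (fun i j : {v : V // v ≠ x} => conductance G w i j)
      (fun i => conductance G w i x) := by
  have hpos : ∀ i j, G.Adj i j → 0 < conductance G w i j := fun i j h => by
    rw [conductance, if_pos h]
    exact hw _ (SimpleGraph.mem_edgeFinset.2 h)
  rintro S ⟨i, hi⟩
  obtain ⟨p⟩ := hG.preconnected i x
  obtain ⟨d, hd, h1, h2⟩ := p.exists_boundary_dart (Subtype.val '' S) ⟨i, hi, rfl⟩
    (by rintro ⟨j, -, hj⟩; exact j.2 hj)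
  obtain ⟨k, hk, hk'⟩ := h1
  refine ⟨k, hk, ?_⟩
  have hadj := d.adj
  rw [← hk'] at hadj
  by_cases hx : d.snd = x
  · left
    rw [hx] at hadj
    exact hpos _ _ hadj
  · right
    exact ⟨⟨d.snd, hx⟩, fun h => h2 ⟨_, h, rfl⟩, hpos _ _ hadj⟩

lemma sum_conductance_root (G : SimpleGraph V) [DecidableRel G.Adj] (w : Sym2 V → ℝ) (x : V) :
    (∑ i : {v : V // v ≠ x}, ∑ j : {v : V // v ≠ x}, conductance G w i j) / 2 +
      ∑ i : {v : V // v ≠ x}, conductance G w i x = ∑ e ∈ G.edgeFinset, w e := by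
  have h := sum_vw G w
  simp only [vw_eq_sum_conductance] at h
  rw [Fintype.sum_eq_add_sum_subtype_ne _ x] at h
  simp only [Fintype.sum_eq_add_sum_subtype_ne _ x, Finset.sum_add_distrib,
    conductance_comm G w x] at h
  have h0 : conductance G w x x = 0 := by simp [conductance]
  rw [h0] at h
  linarith

lemma lintegral_edge_jointDensity {G : SimpleGraph V} [DecidableRel G.Adj] (hG : G.Connected)
    (x : V) {B : Sym2 V → ℝ} (hB : ∀ e ∈ G.edgeFinset, 0 < B e) :
    ∫⁻ w, ∫⁻ y, ENNReal.ofReal (jointDensity G x B (edgeExt G w) y)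
        ∂piHaar {v : V // v ≠ x} ∂piHaar {e // e ∈ G.edgeFinset} =
      ENNReal.ofReal (√(2 * π) ^ (Fintype.card V - 1) *
        ∏ e ∈ G.edgeFinset, Real.Gamma (B e)) := by
  have hm := measurable_jointDensity G x B
  have hmE := measurable_edgeExt G
  have hmS := measurable_sprod_fieldExt x
  have hcard : Fintype.card {v : V // v ≠ x} = Fintype.card V - 1 := by
    rw [Fintype.card_subtype_compl, Fintype.card_subtype_eq]
  rw [lintegral_lintegral_swap]
  swap
  · exact (hm.comp ((hmE.comp measurable_fst).prodMk measurable_snd)).ennreal_ofReal.aemeasurable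
  have hscale : ∀ (y : {v : V // v ≠ x} → ℝ) (w : {e // e ∈ G.edgeFinset} → ℝ),
      edgeExt G (fun e => sprod (fieldExt x y) e * w e) =
        fun e => sprod (fieldExt x y) e * edgeExt G w e := by
    intro y w
    ext e
    unfold edgeExt
    split_ifs <;> simp
  have h1 : ∀ y : {v : V // v ≠ x} → ℝ, (∀ v, 0 < y v) →
      ∫⁻ w, ENNReal.ofReal (jointDensity G x B (edgeExt G w) y) ∂piHaar {e // e ∈ G.edgeFinset} =
      ∫⁻ w, ENNReal.ofReal (jointDensity G x B
        (fun e => sprod (fieldExt x y) e * edgeExt G w e) y) ∂piHaar {e // e ∈ G.edgeFinset} := by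
    intro y hy
    rw [← lintegral_piHaar_mul (c := fun e : {e // e ∈ G.edgeFinset} => sprod (fieldExt x y) e)
      (fun e => sprod_pos (fieldExt_pos hy) e)]
    · simp only [hscale]
    · exact (hm.comp (hmE.prodMk measurable_const)).ennreal_ofReal
  have hmP : Measurable fun p : ({v : V // v ≠ x} → ℝ) × ({e // e ∈ G.edgeFinset} → ℝ) =>
      (fun e => sprod (fieldExt x p.1) e * edgeExt G p.2 e, p.1) := by
    refine Measurable.prodMk (measurable_pi_iff.2 fun e => ?_) measurable_fst
    have h1 : Measurable fun w => edgeExt G w e := measurable_pi_iff.1 hmE e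
    exact ((hmS e).comp measurable_fst).mul (h1.comp measurable_snd)
  rw [lintegral_congr_ae ((ae_piHaar_pos _).mono h1),
    lintegral_lintegral_swap (hm.comp hmP).ennreal_ofReal.aemeasurable]
  have h2 : ∀ w : {e // e ∈ G.edgeFinset} → ℝ, (∀ e, 0 < w e) →
      ∫⁻ y, ENNReal.ofReal (jointDensity G x B
        (fun e => sprod (fieldExt x y) e * edgeExt G w e) y) ∂piHaar {v : V // v ≠ x} =
      ENNReal.ofReal (√(2 * π) ^ (Fintype.card V - 1)) *
        ∏ e : {e // e ∈ G.edgeFinset}, ENNReal.ofReal (w e ^ B e * Real.exp (-(1 * w e))) := by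
    intro w hw
    have hw' := edgeExt_pos hw
    have hP : 0 ≤ ∏ e ∈ G.edgeFinset, edgeExt G w e ^ B e :=
      Finset.prod_nonneg fun e he => Real.rpow_nonneg (hw' e he).le _
    rw [lintegral_congr_ae ((ae_piHaar_pos _).mono fun y hy => by
      rw [jointDensity_sprod_mul x B hw' hy, ENNReal.ofReal_mul hP]),
      lintegral_const_mul _ (measurable_fieldDensity _ _).ennreal_ofReal,
      lintegral_fieldDensity (fun _ _ => conductance_comm _ _ _ _)
        (fun _ _ => conductance_nonneg hw' _ _) (fun _ => conductance_nonneg hw' _ _)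
        (grounded_conductance hG x hw'), hcard, ← ENNReal.ofReal_mul hP,
      ← ENNReal.ofReal_prod_of_nonneg, ← ENNReal.ofReal_mul (by positivity)]
    · congr 1
      have h3 := sum_conductance_root G (edgeExt G w) x
      rw [Finset.prod_mul_distrib, ← Real.exp_sum]
      rw [← Finset.sum_coe_sort G.edgeFinset] at h3
      rw [← Finset.prod_coe_sort G.edgeFinset]
      simp only [edgeExt_coe, one_mul, Finset.sum_neg_distrib] at h3 ⊢
      rw [← h3, mul_left_comm]
      congr 3
      ring
    · intro e _
      have := hw e
      positivity
  rw [lintegral_congr_ae ((ae_piHaar_pos _).mono h2), lintegral_const_mul _ (by fun_prop), piHaar,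
    lintegral_pi_prod mulHaar (f := fun (e : {e // e ∈ G.edgeFinset}) t =>
      ENNReal.ofReal (t ^ B e * Real.exp (-(1 * t)))) (fun e => by fun_prop),
    Finset.prod_congr rfl fun e _ => lintegral_mulHaar_gamma (hB _ e.2) one_pos,
    ← ENNReal.ofReal_prod_of_nonneg, ← ENNReal.ofReal_mul (by positivity)]
  · simp only [Real.one_rpow, one_mul]
    rw [Finset.prod_coe_sort G.edgeFinset fun e => Real.Gamma (B e)]
  · intro e _
    have := Real.Gamma_pos_of_pos (hB _ e.2)
    positivity

/-- The edges are the reference edge together with the other ones. -/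
def pinEquiv (G : SimpleGraph V) [DecidableRel G.Adj] {e0 : Sym2 V} (he0 : e0 ∈ G.edgeFinset) :
    Option (Epin G e0) ≃ {e // e ∈ G.edgeFinset} where
  toFun o := o.elim ⟨e0, he0⟩ fun e => ⟨e, e.2.1⟩
  invFun e := if h : (e : Sym2 V) = e0 then none else some ⟨e, e.2, h⟩
  left_inv o := by
    cases o with
    | none => simp
    | some e => simp [e.2.2]
  right_inv e := by
    by_cases h : (e : Sym2 V) = e0
    · simp [h, ← Subtype.coe_inj]
    · simp [h]

lemma mul_pinExt (G : SimpleGraph V) [DecidableRel G.Adj] {e0 : Sym2 V} (he0 : e0 ∈ G.edgeFinset)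
    (t : ℝ) (u : Epin G e0 → ℝ) :
    (fun e => t * pinExt G e0 u e) =
      edgeExt G fun e => ((pinEquiv G he0).symm e).elim t fun i => t * u i := by
  ext e
  by_cases h : e = e0
  · simp [pinExt, edgeExt, pinEquiv, h, he0]
  · by_cases h' : e ∈ G.edgeFinset
    · simp only [pinExt, edgeExt, pinEquiv, h', Equiv.coe_fn_symm_mk]
      simp [h]
    · simp only [pinExt, edgeExt, h, h']
      simp

lemma pinExt_pos_iff {G : SimpleGraph V} [DecidableRel G.Adj] {e0 : Sym2 V}
    {u : Epin G e0 → ℝ} : (∀ e ∈ G.edgeFinset, 0 < pinExt G e0 u e) ↔ ∀ i, 0 < u i := by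
  refine ⟨fun h i => ?_, fun h e he => ?_⟩
  · have := h i i.2.1
    rwa [pinExt, if_neg i.2.2, dif_pos i.2] at this
  · unfold pinExt
    split_ifs with h1 h2
    exacts [one_pos, h _, absurd ⟨he, h1⟩ h2]

lemma prod_pinExt (G : SimpleGraph V) [DecidableRel G.Adj] {e0 : Sym2 V} (he0 : e0 ∈ G.edgeFinset)
    (u : Epin G e0 → ℝ) : ∏ e ∈ G.edgeFinset, pinExt G e0 u e = ∏ i, u i := by
  rw [← Finset.prod_coe_sort, ← (pinEquiv G he0).prod_comp, Fintype.prod_option]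
  have h0 : pinExt G e0 u (pinEquiv G he0 none) = 1 := by simp [pinEquiv, pinExt]
  rw [h0, one_mul]
  refine Finset.prod_congr rfl fun i _ => ?_
  have h1 : ((pinEquiv G he0 (some i) : {e // e ∈ G.edgeFinset}) : Sym2 V) = i := rfl
  rw [h1, pinExt, if_neg i.2.2, dif_pos i.2]

lemma measurable_pinExt (G : SimpleGraph V) [DecidableRel G.Adj] (e0 : Sym2 V) :
    Measurable (pinExt G e0) := by
  refine measurable_pi_iff.2 fun e => ?_
  unfold pinExt
  split_ifs <;> fun_prop

lemma lintegral_haarDensity {G : SimpleGraph V} [DecidableRel G.Adj] (hG : G.Connected)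
    (hd : ∀ v, ∃ u, G.Adj v u) {e0 : Sym2 V} (he0 : e0 ∈ G.edgeFinset) (x : V) {B : Sym2 V → ℝ}
    (hB : ∀ e ∈ G.edgeFinset, 0 < B e) :
    ENNReal.ofReal (2 * ∏ v, (2 ^ bwt G x B v * (1 / 2) * Real.Gamma (bwt G x B v))) *
        ∫⁻ u, ENNReal.ofReal (haarDensity G x B (pinExt G e0 u)) ∂piHaar (Epin G e0) =
      ENNReal.ofReal (√(2 * π) ^ (Fintype.card V - 1) *
        ∏ e ∈ G.edgeFinset, Real.Gamma (B e)) := by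
  have hm := measurable_jointDensity G x B
  let Q : (Sym2 V → ℝ) → ℝ≥0∞ := fun w =>
    ∫⁻ y, ENNReal.ofReal (jointDensity G x B w y) ∂piHaar {v : V // v ≠ x}
  have hQ : Measurable Q := hm.ennreal_ofReal.lintegral_prod_right'
  have hQdef : ∀ w, ∫⁻ y, ENNReal.ofReal (jointDensity G x B w y) ∂piHaar {v : V // v ≠ x} = Q w :=
    fun _ => rfl
  clear_value Q
  have hmh : Measurable (haarDensity G x B) := by
    unfold haarDensity tau vw
    fun_prop
  have hmE := measurable_edgeExt G
  have hmP := measurable_pinExt G e0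
  have helim : ∀ o : Option (Epin G e0), Measurable fun p : (Epin G e0 → ℝ) × ℝ =>
      o.elim p.2 p.1 := by
    rintro (_ | i)
    · exact measurable_snd
    · exact (measurable_pi_apply i).comp measurable_fst
  have hm1 : Measurable fun p : (Epin G e0 → ℝ) × ℝ =>
      Q (edgeExt G fun e => ((pinEquiv G he0).symm e).elim p.2 p.1) :=
    hQ.comp (hmE.comp (measurable_pi_iff.2 fun e => helim _))
  have hm2 : Measurable fun p : (Epin G e0 → ℝ) × ℝ =>
      Q fun e => p.2 * pinExt G e0 p.1 e :=
    hQ.comp (measurable_pi_iff.2 fun e =>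
      measurable_snd.mul ((measurable_pi_iff.1 hmP e).comp measurable_fst))
  rw [← lintegral_edge_jointDensity hG x hB]
  simp only [hQdef]
  rw [lintegral_piHaar_equiv (pinEquiv G he0),
    lintegral_piHaar_option (f := fun w => Q (edgeExt G fun k => w ((pinEquiv G he0).symm k)))
      (hQ.comp (hmE.comp (by fun_prop))),
    lintegral_lintegral_swap hm1.aemeasurable]
  have h1 : ∀ t : ℝ, 0 < t → ∫⁻ u, Q (edgeExt G fun e => ((pinEquiv G he0).symm e).elim t u)
      ∂piHaar (Epin G e0) = ∫⁻ u, Q (fun e => t * pinExt G e0 u e) ∂piHaar (Epin G e0) := by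
    intro t ht
    rw [← lintegral_piHaar_mul (c := fun _ => t) (fun _ => ht)]
    · simp only [mul_pinExt G he0]
    · exact hm1.comp (measurable_id.prodMk measurable_const)
  rw [lintegral_congr_ae (ae_mulHaar_pos.mono h1),
    ← lintegral_lintegral_swap hm2.aemeasurable, ← lintegral_const_mul _ (by fun_prop)]
  refine lintegral_congr_ae ((ae_piHaar_pos _).mono fun u hu => ?_)
  have h2 := lintegral_lintegral_jointDensity hd x hB (pinExt_pos_iff.2 hu)
  simp only [hQdef] at h2
  exact h2.symm

lemma Znorm_pos {G : SimpleGraph V} [DecidableRel G.Adj] (hd : ∀ v, ∃ u, G.Adj v u) (x : V)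
    {B : Sym2 V → ℝ} (hB : ∀ e ∈ G.edgeFinset, 0 < B e) : 0 < Znorm G x B := by
  have h1 : 0 < ∏ e ∈ G.edgeFinset, Real.Gamma (B e) :=
    Finset.prod_pos fun e he => Real.Gamma_pos_of_pos (hB e he)
  have h2 : 0 < ∏ v, Real.Gamma (bwt G x B v) :=
    Finset.prod_pos fun v _ => Real.Gamma_pos_of_pos (bwt_pos hd hB x v)
  unfold Znorm
  positivity

lemma Znorm_mul {G : SimpleGraph V} [DecidableRel G.Adj] (hd : ∀ v, ∃ u, G.Adj v u) (x : V)
    {B : Sym2 V → ℝ} (hB : ∀ e ∈ G.edgeFinset, 0 < B e) :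
    (2 * ∏ v, (2 ^ bwt G x B v * (1 / 2) * Real.Gamma (bwt G x B v))) * Znorm G x B =
      √(2 * π) ^ (Fintype.card V - 1) * ∏ e ∈ G.edgeFinset, Real.Gamma (B e) := by
  have h2 : 0 < ∏ v, Real.Gamma (bwt G x B v) :=
    Finset.prod_pos fun v _ => Real.Gamma_pos_of_pos (bwt_pos hd hB x v)
  have hn : 1 ≤ Fintype.card V := Fintype.card_pos_iff.2 ⟨x⟩
  have h3 : √(2 * π) ^ (Fintype.card V - 1) =
      2 ^ (((Fintype.card V : ℝ) - 1) / 2) * π ^ (((Fintype.card V : ℝ) - 1) / 2) := by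
    rw [Real.sqrt_eq_rpow, ← Real.rpow_natCast, ← Real.rpow_mul (by positivity),
      ← Real.mul_rpow zero_le_two Real.pi_pos.le]
    congr 1
    push_cast [hn]
    ring
  have h4 : ∏ v : V, ((2 : ℝ) ^ bwt G x B v * (1 / 2)) =
      2 ^ ((∑ e ∈ G.edgeFinset, B e) + ((Fintype.card V : ℝ) - 1) / 2) *
        2 ^ (-(Fintype.card V : ℝ)) := by
    rw [Finset.prod_mul_distrib, ← Real.rpow_sum_of_pos two_pos, sum_bwt, Finset.prod_const,
      Finset.card_univ, Real.rpow_neg zero_le_two, Real.rpow_natCast]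
    simp
  rw [Finset.prod_mul_distrib, h4, h3, Znorm]
  have h5 : (2 : ℝ) * (2 ^ ((∑ e ∈ G.edgeFinset, B e) + ((Fintype.card V : ℝ) - 1) / 2) *
        2 ^ (-(Fintype.card V : ℝ))) = 2 ^ (((Fintype.card V : ℝ) - 1) / 2) *
      2 ^ ((1 : ℝ) - (Fintype.card V : ℝ) + ∑ e ∈ G.edgeFinset, B e) := by
    nth_rewrite 1 [← Real.rpow_one 2]
    rw [← Real.rpow_add two_pos, ← Real.rpow_add two_pos, ← Real.rpow_add two_pos]
    congr 1
    ring
  rw [← mul_assoc, h5]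
  field_simp

/-- The magic formula density is a probability density. -/
theorem lintegral_magicDensity {G : SimpleGraph V} [DecidableRel G.Adj] (hG : G.Connected)
    (hd : ∀ v, ∃ u, G.Adj v u) {e0 : Sym2 V} (he0 : e0 ∈ G.edgeFinset) (x : V) {B : Sym2 V → ℝ}
    (hB : ∀ e ∈ G.edgeFinset, 0 < B e) :
    ∫⁻ u : Epin G e0 → ℝ, ENNReal.ofReal
        (if ∀ e ∈ G.edgeFinset, 0 < pinExt G e0 u e then
          magicDensity G x B (pinExt G e0 u) else 0) = 1 := by
  have hZ := Znorm_pos hd x hB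
  have hmP := measurable_pinExt G e0
  have hmM : Measurable fun u => ENNReal.ofReal (magicDensity G x B (pinExt G e0 u)) := by
    have : Measurable (magicDensity G x B) := by
      unfold magicDensity tau vw
      fun_prop
    exact (this.comp hmP).ennreal_ofReal
  have hS : MeasurableSet (Set.univ.pi fun _ : Epin G e0 => Set.Ioi (0 : ℝ)) :=
    MeasurableSet.univ_pi fun _ => measurableSet_Ioi
  have h1 : ∫⁻ u : Epin G e0 → ℝ, ENNReal.ofReal
        (if ∀ e ∈ G.edgeFinset, 0 < pinExt G e0 u e then
          magicDensity G x B (pinExt G e0 u) else 0) =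
      ENNReal.ofReal (Znorm G x B)⁻¹ *
        ∫⁻ u, ENNReal.ofReal (haarDensity G x B (pinExt G e0 u)) ∂piHaar (Epin G e0) := by
    have hmh : Measurable (haarDensity G x B) := by
      unfold haarDensity tau vw
      fun_prop
    rw [← lintegral_const_mul _ (by fun_prop)]
    have h2 : ∀ u : Epin G e0 → ℝ, ENNReal.ofReal
        (if ∀ e ∈ G.edgeFinset, 0 < pinExt G e0 u e then
          magicDensity G x B (pinExt G e0 u) else 0) =
        (Set.univ.pi fun _ : Epin G e0 => Set.Ioi (0 : ℝ)).indicator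
          (fun u => ENNReal.ofReal (magicDensity G x B (pinExt G e0 u))) u := by
      intro u
      have : u ∈ (Set.univ.pi fun _ : Epin G e0 => Set.Ioi (0 : ℝ)) ↔
          ∀ e ∈ G.edgeFinset, 0 < pinExt G e0 u e := by
        rw [pinExt_pos_iff]; simp
      rw [Set.indicator_apply]
      simp only [this]
      split_ifs <;> simp
    simp only [h2]
    rw [lintegral_indicator hS, setLIntegral_pos_eq_piHaar hmM]
    refine lintegral_congr_ae ((ae_piHaar_pos _).mono fun u hu => ?_)
    have hw := pinExt_pos_iff.2 hu
    simp only
    rw [← ENNReal.ofReal_mul (by positivity), ← magicDensity_eq hd x B hw, prod_pinExt G he0,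
      ENNReal.ofReal_mul (Finset.prod_nonneg fun i _ => (hu i).le),
      ENNReal.ofReal_prod_of_nonneg fun i _ => (hu i).le]
  set K := 2 * ∏ v, (2 ^ bwt G x B v * (1 / 2) * Real.Gamma (bwt G x B v)) with hK
  have hK0 : 0 < K := mul_pos two_pos (Finset.prod_pos fun v _ => by
    have := Real.Gamma_pos_of_pos (bwt_pos hd hB x v)
    positivity)
  have h3 := lintegral_haarDensity hG hd he0 x hB
  rw [← Znorm_mul hd x hB, ← hK, ENNReal.ofReal_mul hK0.le] at h3
  have h4 := (ENNReal.mul_right_inj (ENNReal.ofReal_pos.2 hK0).ne' ENNReal.ofReal_ne_top).1 h3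
  rw [h1, h4, ← ENNReal.ofReal_mul (by positivity), inv_mul_cancel₀ hZ.ne', ENNReal.ofReal_one]

lemma vw_add_single {G : SimpleGraph V} [DecidableRel G.Adj] {x y : V} (h : G.Adj x y)
    (B : Sym2 V → ℝ) (v : V) :
    vw G (fun e => B e + if s(x, y) = e then 1 else 0) v =
      vw G B v + ((if v = x then 1 else 0) + if v = y then 1 else 0) := by
  simp only [vw, Finset.sum_add_distrib]
  congr 1
  by_cases hx : v = x
  · subst hx
    rw [Finset.sum_eq_single_of_mem y ((G.mem_neighborFinset _ _).2 h)]
    · simp [h.ne]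
    · intro j _ hj
      refine if_neg fun hh => hj ?_
      rcases Sym2.eq_iff.1 hh with ⟨-, h1⟩ | ⟨-, h1⟩
      exacts [h1.symm, absurd h1.symm h.ne]
  by_cases hy : v = y
  · subst hy
    rw [Finset.sum_eq_single_of_mem x ((G.mem_neighborFinset _ _).2 h.symm)]
    · simp [h.ne', Sym2.eq_swap]
    · intro j _ hj
      refine if_neg fun hh => hj ?_
      rcases Sym2.eq_iff.1 hh with ⟨h1, -⟩ | ⟨h1, -⟩
      exacts [absurd h1 h.ne, h1.symm]
  · rw [Finset.sum_eq_zero fun j _ => if_neg fun hh => ?_]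
    · simp [hx, hy]
    · rcases Sym2.eq_iff.1 hh with ⟨h1, -⟩ | ⟨-, h1⟩
      exacts [hx h1.symm, hy h1.symm]

lemma bwt_add_single {G : SimpleGraph V} [DecidableRel G.Adj] {x y : V} (h : G.Adj x y)
    (B : Sym2 V → ℝ) (v : V) :
    bwt G y (fun e => B e + if s(x, y) = e then 1 else 0) v =
      bwt G x B v + if v = x then 1 else 0 := by
  rw [bwt, vw_add_single h, bwt]
  split_ifs <;> ring

lemma haarDensity_add_single {G : SimpleGraph V} [DecidableRel G.Adj]
    (hd : ∀ v, ∃ u, G.Adj v u) {x y : V} (h : G.Adj x y) (B : Sym2 V → ℝ) {w : Sym2 V → ℝ}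
    (hw : ∀ e ∈ G.edgeFinset, 0 < w e) :
    haarDensity G y (fun e => B e + if s(x, y) = e then 1 else 0) w =
      w s(x, y) / vw G w x * haarDensity G x B w := by
  have hmem : s(x, y) ∈ G.edgeFinset := SimpleGraph.mem_edgeFinset.2 h
  have h1 : ∏ e ∈ G.edgeFinset, w e ^ (B e + if s(x, y) = e then 1 else 0) =
      (∏ e ∈ G.edgeFinset, w e ^ B e) * w s(x, y) := by
    rw [← Finset.prod_ite_eq_of_mem G.edgeFinset s(x, y) w hmem, ← Finset.prod_mul_distrib]
    refine Finset.prod_congr rfl fun e he => ?_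
    split_ifs
    · exact Real.rpow_add_one (hw e he).ne' _
    · rw [add_zero, mul_one]
  have h2 : ∏ v, vw G w v ^ (-(bwt G x B v + if v = x then 1 else 0)) =
      (∏ v, vw G w v ^ (-bwt G x B v)) * (vw G w x)⁻¹ := by
    rw [← Finset.prod_ite_eq_of_mem' Finset.univ x (fun v => (vw G w v)⁻¹) (Finset.mem_univ x),
      ← Finset.prod_mul_distrib]
    refine Finset.prod_congr rfl fun v _ => ?_
    have hv := vw_pos hd hw v
    split_ifs
    · rw [neg_add, Real.rpow_add hv, Real.rpow_neg_one]
    · rw [add_zero, mul_one]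
  simp only [haarDensity, bwt_add_single h]
  rw [h1, h2]
  ring

lemma Znorm_add_single {G : SimpleGraph V} [DecidableRel G.Adj]
    (hd : ∀ v, ∃ u, G.Adj v u) {x y : V} (h : G.Adj x y) {B : Sym2 V → ℝ}
    (hB : ∀ e ∈ G.edgeFinset, 0 < B e) :
    Znorm G y (fun e => B e + if s(x, y) = e then 1 else 0) =
      B s(x, y) / vw G B x * Znorm G x B := by
  have hmem : s(x, y) ∈ G.edgeFinset := SimpleGraph.mem_edgeFinset.2 h
  have h1 : ∏ e ∈ G.edgeFinset, Real.Gamma (B e + if s(x, y) = e then 1 else 0) =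
      (∏ e ∈ G.edgeFinset, Real.Gamma (B e)) * B s(x, y) := by
    rw [← Finset.prod_ite_eq_of_mem G.edgeFinset s(x, y) B hmem, ← Finset.prod_mul_distrib]
    refine Finset.prod_congr rfl fun e he => ?_
    split_ifs
    · rw [Real.Gamma_add_one (hB e he).ne', mul_comm]
    · rw [add_zero, mul_one]
  have h2 : ∏ v, Real.Gamma (bwt G x B v + if v = x then 1 else 0) =
      (∏ v, Real.Gamma (bwt G x B v)) * (vw G B x / 2) := by
    have hx : vw G B x / 2 = bwt G x B x := by simp [bwt]
    rw [hx, ← Finset.prod_ite_eq_of_mem' Finset.univ x (bwt G x B) (Finset.mem_univ x),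
      ← Finset.prod_mul_distrib]
    refine Finset.prod_congr rfl fun v _ => ?_
    split_ifs
    · rw [Real.Gamma_add_one (bwt_pos hd hB x v).ne', mul_comm]
    · rw [add_zero, mul_one]
  have h3 : ∑ e ∈ G.edgeFinset, (B e + if s(x, y) = e then 1 else 0) =
      (∑ e ∈ G.edgeFinset, B e) + 1 := by
    rw [Finset.sum_add_distrib, Finset.sum_ite_eq_of_mem G.edgeFinset s(x, y) _ hmem]
  simp only [Znorm, bwt_add_single h]
  rw [h1, h2, h3, ← add_assoc, Real.rpow_add_one two_ne_zero]
  have := (vw_pos hd hB x).ne'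
  have : ∏ v, Real.Gamma (bwt G x B v) ≠ 0 :=
    Finset.prod_ne_zero_iff.2 fun v _ => (Real.Gamma_pos_of_pos (bwt_pos hd hB x v)).ne'
  field_simp

lemma qstep_mul_magicDensity {G : SimpleGraph V} [DecidableRel G.Adj]
    (hd : ∀ v, ∃ u, G.Adj v u) {x y : V} (h : G.Adj x y) {B w : Sym2 V → ℝ}
    (hB : ∀ e ∈ G.edgeFinset, 0 < B e) (hw : ∀ e ∈ G.edgeFinset, 0 < w e) :
    qstep G w x y * magicDensity G x B w = B s(x, y) / vw G B x *
      magicDensity G y (fun e => B e + if s(x, y) = e then 1 else 0) w := by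
  have hP : ∏ e ∈ G.edgeFinset, w e ≠ 0 := (Finset.prod_pos hw).ne'
  refine mul_left_cancel₀ hP ?_
  rw [qstep, if_pos h, mul_left_comm (∏ e ∈ G.edgeFinset, w e), magicDensity_eq hd x B hw,
    mul_left_comm (∏ e ∈ G.edgeFinset, w e) (B s(x, y) / vw G B x),
    magicDensity_eq hd y _ hw, haarDensity_add_single hd h B hw, Znorm_add_single hd h hB]
  have := (vw_pos hd hB x).ne'
  have := (hB s(x, y) (SimpleGraph.mem_edgeFinset.2 h)).ne'
  have := (Znorm_pos hd x hB).ne'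
  field_simp

lemma localTime_succ (a : Sym2 V → ℝ) (X : ℕ → V) (t : ℕ) :
    localTime a X (t + 1) =
      fun e => localTime a X t e + if s(X t, X (t + 1)) = e then 1 else 0 := by
  ext e
  simp only [localTime, Finset.range_add_one, Finset.filter_insert]
  split_ifs
  · rw [Finset.card_insert_of_notMem (by simp)]
    push_cast
    ring
  · ring

lemma localTime_pos {G : SimpleGraph V} [DecidableRel G.Adj] {a : Sym2 V → ℝ}
    (ha : ∀ e ∈ G.edgeFinset, 0 < a e) (X : ℕ → V) (t : ℕ) (e : Sym2 V) (he : e ∈ G.edgeFinset) :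
    0 < localTime a X t e :=
  add_pos_of_pos_of_nonneg (ha e he) (Nat.cast_nonneg _)

lemma prod_qstep_mul_magicDensity {G : SimpleGraph V} [DecidableRel G.Adj]
    (hd : ∀ v, ∃ u, G.Adj v u) {a w : Sym2 V → ℝ} (ha : ∀ e ∈ G.edgeFinset, 0 < a e)
    (hw : ∀ e ∈ G.edgeFinset, 0 < w e) (X : ℕ → V) (T : ℕ) :
    (∏ t ∈ Finset.range T, qstep G w (X t) (X (t + 1))) * magicDensity G (X 0) a w =
      (∏ t ∈ Finset.range T, errwStep G a X t) * magicDensity G (X T) (localTime a X T) w := by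
  induction T with
  | zero =>
    have : localTime a X 0 = a := by ext e; simp [localTime]
    simp [this]
  | succ T ih =>
    rw [Finset.prod_range_succ, Finset.prod_range_succ, mul_right_comm, ih]
    by_cases h : G.Adj (X T) (X (T + 1))
    · have h1 := qstep_mul_magicDensity hd h (localTime_pos ha X T) hw
      rw [← localTime_succ] at h1
      have h2 : errwStep G a X T =
          localTime a X T s(X T, X (T + 1)) / vw G (localTime a X T) (X T) := by
        rw [errwStep, if_pos h]
        rfl
      rw [h2]
      linear_combination (∏ t ∈ Finset.range T, errwStep G a X t) * h1
    · rw [qstep, errwStep, if_neg h, if_neg h]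
      ring

lemma errwStep_nonneg {G : SimpleGraph V} [DecidableRel G.Adj] {a : Sym2 V → ℝ}
    (ha : ∀ e ∈ G.edgeFinset, 0 < a e) (X : ℕ → V) (t : ℕ) : 0 ≤ errwStep G a X t := by
  unfold errwStep
  split_ifs with h
  · exact div_nonneg (localTime_pos ha X t _ (SimpleGraph.mem_edgeFinset.2 h)).le
      (Finset.sum_nonneg fun u hu => (localTime_pos ha X t _ (SimpleGraph.mem_edgeFinset.2
        ((G.mem_neighborFinset _ _).1 hu))).le)
  · exact le_rfl

lemma errwProb_nonneg {G : SimpleGraph V} [DecidableRel G.Adj] {a : Sym2 V → ℝ}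
    (ha : ∀ e ∈ G.edgeFinset, 0 < a e) (v0 : V) (T : ℕ) (x : Fin (T + 1) → V) :
    0 ≤ errwProb G v0 a T x := by
  unfold errwProb
  split_ifs
  exacts [Finset.prod_nonneg fun t _ => errwStep_nonneg ha _ t, le_rfl]

lemma measurable_qstep (G : SimpleGraph V) [DecidableRel G.Adj] (i j : V) :
    Measurable fun w => qstep G w i j := by
  unfold qstep vw
  split_ifs <;> fun_prop

lemma measurable_quenchedProb (G : SimpleGraph V) [DecidableRel G.Adj] (v0 : V) (T : ℕ)
    (x : Fin (T + 1) → V) : Measurable fun w => quenchedProb G v0 w T x := by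
  unfold quenchedProb
  split_ifs
  · exact Finset.measurable_prod _ fun t _ => measurable_qstep G _ _
  · fun_prop

lemma measurable_pinDensity (G : SimpleGraph V) [DecidableRel G.Adj] (e0 : Sym2 V) (x : V)
    (B : Sym2 V → ℝ) : Measurable fun u : Epin G e0 → ℝ => ENNReal.ofReal
      (if ∀ e ∈ G.edgeFinset, 0 < pinExt G e0 u e then
        magicDensity G x B (pinExt G e0 u) else 0) := by
  have h1 : Measurable (magicDensity G x B) := by
    unfold magicDensity tau vw
    fun_prop
  refine Measurable.ennreal_ofReal (Measurable.ite ?_ (h1.comp (measurable_pinExt G e0))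
    measurable_const)
  have h2 : {u : Epin G e0 → ℝ | ∀ e ∈ G.edgeFinset, 0 < pinExt G e0 u e} =
      Set.univ.pi fun _ => Set.Ioi 0 := by
    ext u
    simp only [Set.mem_ofPred_eq, pinExt_pos_iff]
    simp
  rw [h2]
  exact MeasurableSet.univ_pi fun _ => measurableSet_Ioi

lemma isProbabilityMeasure_mixing {G : SimpleGraph V} [DecidableRel G.Adj] (hG : G.Connected)
    (hd : ∀ v, ∃ u, G.Adj v u) {e0 : Sym2 V} (he0 : e0 ∈ G.edgeFinset) (x : V) {B : Sym2 V → ℝ}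
    (hB : ∀ e ∈ G.edgeFinset, 0 < B e) : IsProbabilityMeasure (mixing G e0 x B) := by
  refine ⟨?_⟩
  rw [mixing, Measure.map_apply (measurable_pinExt G e0) MeasurableSet.univ, Set.preimage_univ,
    withDensity_apply _ MeasurableSet.univ, Measure.restrict_univ]
  exact lintegral_magicDensity hG hd he0 x hB

lemma ae_mixing_pos (G : SimpleGraph V) [DecidableRel G.Adj] (e0 : Sym2 V) (x : V)
    (B : Sym2 V → ℝ) : ∀ᵐ w ∂mixing G e0 x B, ∀ e ∈ G.edgeFinset, 0 < w e := by
  have hS : MeasurableSet {w : Sym2 V → ℝ | ∀ e ∈ G.edgeFinset, 0 < w e} := by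
    simp only [Set.ofPred_forall]
    exact Finset.measurableSet_biInter _ fun e _ =>
      measurableSet_lt measurable_const (measurable_pi_apply e)
  rw [mixing, ae_map_iff (measurable_pinExt G e0).aemeasurable hS,
    ae_withDensity_iff (measurable_pinDensity G e0 x B)]
  refine Eventually.of_forall fun u hu => ?_
  by_contra h
  exact hu (by rw [if_neg h, ENNReal.ofReal_zero])

/-- The ERRW is a mixture of quenched chains. -/
theorem lintegral_quenchedProb {G : SimpleGraph V} [DecidableRel G.Adj] (hG : G.Connected)
    (hd : ∀ v, ∃ u, G.Adj v u) {e0 : Sym2 V} (he0 : e0 ∈ G.edgeFinset) (v0 : V) {a : Sym2 V → ℝ}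
    (ha : ∀ e ∈ G.edgeFinset, 0 < a e) (T : ℕ) (x : Fin (T + 1) → V) :
    ∫⁻ w, ENNReal.ofReal (quenchedProb G v0 w T x) ∂mixing G e0 v0 a =
      ENNReal.ofReal (errwProb G v0 a T x) := by
  have hm := (measurable_quenchedProb G v0 T x).ennreal_ofReal
  by_cases hx : x 0 = v0
  swap
  · simp [quenchedProb, errwProb, hx]
  set X := extendPath v0 x with hX
  have hX0 : X 0 = v0 := by simp [hX, extendPath, hx]
  have hm' : Measurable fun u => ENNReal.ofReal (quenchedProb G v0 (pinExt G e0 u) T x) :=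
    hm.comp (measurable_pinExt G e0)
  have hE : 0 ≤ ∏ t ∈ Finset.range T, errwStep G a X t :=
    Finset.prod_nonneg fun t _ => errwStep_nonneg ha X t
  rw [mixing, lintegral_map hm (measurable_pinExt G e0),
    lintegral_withDensity_eq_lintegral_mul _ (measurable_pinDensity G e0 v0 a) hm',
    errwProb, if_pos hx,
    ← mul_one (ENNReal.ofReal (∏ t ∈ Finset.range T, errwStep G a X t)),
    ← lintegral_magicDensity hG hd he0 (X T) (localTime_pos ha X T),
    ← lintegral_const_mul _ (measurable_pinDensity G e0 _ _)]
  refine lintegral_congr fun u => ?_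
  simp only [Pi.mul_apply]
  split_ifs with h
  · have h1 := prod_qstep_mul_magicDensity hd ha h X T
    rw [quenchedProb, if_pos hx, ← ENNReal.ofReal_mul hE, ← h1, hX0, mul_comm,
      ← ENNReal.ofReal_mul]
    refine Finset.prod_nonneg fun t _ => ?_
    unfold qstep
    split_ifs with h'
    · exact div_nonneg (h _ (SimpleGraph.mem_edgeFinset.2 h')).le (vw_pos hd h _).le
    · exact le_rfl
  · simp

lemma qstep_eq_conductance (G : SimpleGraph V) [DecidableRel G.Adj] (w : Sym2 V → ℝ) (i j : V) :
    qstep G w i j = conductance G w i j / vw G w i := by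
  unfold qstep conductance
  split_ifs <;> simp

lemma qstep_nonneg {G : SimpleGraph V} [DecidableRel G.Adj] {w : Sym2 V → ℝ}
    (hw : ∀ e ∈ G.edgeFinset, 0 < w e) (i j : V) : 0 ≤ qstep G w i j := by
  rw [qstep_eq_conductance, vw_eq_sum_conductance]
  exact div_nonneg (conductance_nonneg hw i j)
    (Finset.sum_nonneg fun k _ => conductance_nonneg hw i k)

lemma sum_qstep {G : SimpleGraph V} [DecidableRel G.Adj] (hd : ∀ v, ∃ u, G.Adj v u)
    {w : Sym2 V → ℝ} (hw : ∀ e ∈ G.edgeFinset, 0 < w e) (i : V) : ∑ j, qstep G w i j = 1 := by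
  simp only [qstep_eq_conductance]
  rw [← Finset.sum_div, ← vw_eq_sum_conductance, div_self (vw_pos hd hw i).ne']

lemma qstep_le_one {G : SimpleGraph V} [DecidableRel G.Adj] (hd : ∀ v, ∃ u, G.Adj v u)
    {w : Sym2 V → ℝ} (hw : ∀ e ∈ G.edgeFinset, 0 < w e) (i j : V) : qstep G w i j ≤ 1 :=
  (Finset.single_le_sum (fun k _ => qstep_nonneg hw i k) (Finset.mem_univ j)).trans_eq
    (sum_qstep hd hw i)

/-- The transition operator of the quenched chain. -/
def transitionOp (G : SimpleGraph V) [DecidableRel G.Adj] (w : Sym2 V → ℝ) :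
    (V → ℝ) →ₗ[ℝ] V → ℝ where
  toFun f i := ∑ j, qstep G w i j * f j
  map_add' f g := by
    ext i
    simp [mul_add, Finset.sum_add_distrib]
  map_smul' c f := by
    ext i
    simp only [Pi.smul_apply, smul_eq_mul, RingHom.id_apply, Finset.mul_sum]
    exact Finset.sum_congr rfl fun j _ => mul_left_comm _ _ _

lemma transitionOp_apply (G : SimpleGraph V) [DecidableRel G.Adj] (w : Sym2 V → ℝ) (f : V → ℝ)
    (i : V) : transitionOp G w f i = ∑ j, qstep G w i j * f j := rfl

/-- Expectation of `f` at time `T` under the quenched chain. -/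
def expectAt (G : SimpleGraph V) [DecidableRel G.Adj] (v0 : V) (w : Sym2 V → ℝ) (T : ℕ)
    (f : V → ℝ) : ℝ :=
  ∑ x : Fin (T + 1) → V, quenchedProb G v0 w T x * f (x (Fin.last T))

/-- Shannon entropy of the quenched trajectory law. -/
def quenchedEntropy (G : SimpleGraph V) [DecidableRel G.Adj] (v0 : V) (w : Sym2 V → ℝ) (T : ℕ) :
    ℝ :=
  ∑ x : Fin (T + 1) → V, negMulLog (quenchedProb G v0 w T x)

lemma extendPath_snoc {T : ℕ} (v0 : V) (x : Fin (T + 1) → V) (j : V) {t : ℕ} (ht : t < T + 1) :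
    extendPath v0 (Fin.snoc x j : Fin (T + 1 + 1) → V) t = extendPath v0 x t := by
  have h : (⟨t, ht.trans (Nat.lt_succ_self _)⟩ : Fin (T + 1 + 1)) = Fin.castSucc ⟨t, ht⟩ := rfl
  rw [extendPath, dif_pos (ht.trans (Nat.lt_succ_self _)), extendPath, dif_pos ht, h]
  exact Fin.snoc_castSucc (α := fun _ => V) _ _ _

lemma extendPath_last {T : ℕ} (v0 : V) (x : Fin (T + 1) → V) :
    extendPath v0 x T = x (Fin.last T) := by
  rw [extendPath, dif_pos (Nat.lt_succ_self T)]
  rfl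

lemma quenchedProb_snoc (G : SimpleGraph V) [DecidableRel G.Adj] (v0 : V) (w : Sym2 V → ℝ)
    {T : ℕ} (x : Fin (T + 1) → V) (j : V) :
    quenchedProb G v0 w (T + 1) (Fin.snoc x j) =
      quenchedProb G v0 w T x * qstep G w (x (Fin.last T)) j := by
  have h0 : (Fin.snoc x j : Fin (T + 1 + 1) → V) 0 = x 0 :=
    Fin.snoc_castSucc (α := fun _ => V) j x 0
  have h1 : extendPath v0 (Fin.snoc x j : Fin (T + 1 + 1) → V) (T + 1) = j := by
    rw [extendPath_last]
    exact Fin.snoc_last (α := fun _ => V) _ _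
  unfold quenchedProb
  rw [h0]
  split_ifs
  · rw [Finset.prod_range_succ, h1, extendPath_snoc v0 x j (Nat.lt_succ_self T), extendPath_last]
    congr 1
    refine Finset.prod_congr rfl fun t ht => ?_
    have := Finset.mem_range.1 ht
    rw [extendPath_snoc v0 x j (by omega), extendPath_snoc v0 x j (by omega)]
  · rw [zero_mul]

lemma sum_path_succ {T : ℕ} (F : (Fin (T + 1 + 1) → V) → ℝ) :
    ∑ x, F x = ∑ x : Fin (T + 1) → V, ∑ j, F (Fin.snoc x j) := by
  rw [← (Fin.snocEquiv fun _ => V).sum_comp, Fintype.sum_prod_type, Finset.sum_comm]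
  rfl

lemma quenchedProb_nonneg {G : SimpleGraph V} [DecidableRel G.Adj] {w : Sym2 V → ℝ}
    (hw : ∀ e ∈ G.edgeFinset, 0 < w e) (v0 : V) (T : ℕ) (x : Fin (T + 1) → V) :
    0 ≤ quenchedProb G v0 w T x := by
  unfold quenchedProb
  split_ifs
  exacts [Finset.prod_nonneg fun t _ => qstep_nonneg hw _ _, le_rfl]

lemma expectAt_zero (G : SimpleGraph V) [DecidableRel G.Adj] (v0 : V) (w : Sym2 V → ℝ)
    (f : V → ℝ) : expectAt G v0 w 0 f = f v0 := by
  unfold expectAt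
  rw [← (Equiv.funUnique (Fin 1) V).symm.sum_comp]
  simp [quenchedProb]

lemma expectAt_succ (G : SimpleGraph V) [DecidableRel G.Adj] (v0 : V) (w : Sym2 V → ℝ) (T : ℕ)
    (f : V → ℝ) : expectAt G v0 w (T + 1) f = expectAt G v0 w T (transitionOp G w f) := by
  unfold expectAt
  rw [sum_path_succ]
  refine Finset.sum_congr rfl fun x _ => ?_
  simp only [quenchedProb_snoc, transitionOp_apply, Finset.mul_sum, mul_assoc]
  refine Finset.sum_congr rfl fun j _ => ?_
  congr 3
  exact Fin.snoc_last (α := fun _ => V) _ _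

lemma sum_quenchedProb {G : SimpleGraph V} [DecidableRel G.Adj] (hd : ∀ v, ∃ u, G.Adj v u)
    {w : Sym2 V → ℝ} (hw : ∀ e ∈ G.edgeFinset, 0 < w e) (v0 : V) (T : ℕ) :
    ∑ x, quenchedProb G v0 w T x = 1 := by
  have h : ∀ T, expectAt G v0 w T 1 = 1 := by
    intro T
    induction T with
    | zero => rw [expectAt_zero, Pi.one_apply]
    | succ T ih =>
      have h1 : transitionOp G w 1 = 1 := by
        ext i
        simp [transitionOp_apply, sum_qstep hd hw]
      rw [expectAt_succ, h1, ih]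
  simpa [expectAt] using h T

lemma quenchedProb_le_one {G : SimpleGraph V} [DecidableRel G.Adj] (hd : ∀ v, ∃ u, G.Adj v u)
    {w : Sym2 V → ℝ} (hw : ∀ e ∈ G.edgeFinset, 0 < w e) (v0 : V) (T : ℕ)
    (x : Fin (T + 1) → V) : quenchedProb G v0 w T x ≤ 1 :=
  (Finset.single_le_sum (fun k _ => quenchedProb_nonneg hw v0 T k) (Finset.mem_univ x)).trans_eq
    (sum_quenchedProb hd hw v0 T)

/-- Entropy of the transition distribution out of `i`. -/
def stepEntropy (G : SimpleGraph V) [DecidableRel G.Adj] (w : Sym2 V → ℝ) (i : V) : ℝ :=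
  ∑ j, negMulLog (qstep G w i j)

lemma stepEntropy_nonneg {G : SimpleGraph V} [DecidableRel G.Adj] (hd : ∀ v, ∃ u, G.Adj v u)
    {w : Sym2 V → ℝ} (hw : ∀ e ∈ G.edgeFinset, 0 < w e) (i : V) : 0 ≤ stepEntropy G w i :=
  Finset.sum_nonneg fun j _ => negMulLog_nonneg (qstep_nonneg hw i j) (qstep_le_one hd hw i j)

lemma stepEntropy_le {G : SimpleGraph V} [DecidableRel G.Adj]
    {w : Sym2 V → ℝ} (hw : ∀ e ∈ G.edgeFinset, 0 < w e) (i : V) :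
    stepEntropy G w i ≤ Fintype.card V := by
  have h : stepEntropy G w i ≤ ∑ _j : V, (1 : ℝ) := Finset.sum_le_sum fun j _ => by
    linarith [negMulLog_le_one_sub_self (qstep_nonneg hw i j), qstep_nonneg hw i j]
  simpa using h

lemma quenchedEntropy_succ {G : SimpleGraph V} [DecidableRel G.Adj] (hd : ∀ v, ∃ u, G.Adj v u)
    {w : Sym2 V → ℝ} (hw : ∀ e ∈ G.edgeFinset, 0 < w e) (v0 : V) (T : ℕ) :
    quenchedEntropy G v0 w (T + 1) =
      quenchedEntropy G v0 w T + expectAt G v0 w T (stepEntropy G w) := by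
  unfold quenchedEntropy expectAt
  rw [sum_path_succ, ← Finset.sum_add_distrib]
  refine Finset.sum_congr rfl fun x _ => ?_
  simp only [quenchedProb_snoc, negMulLog_mul, Finset.sum_add_distrib]
  rw [← Finset.sum_mul, sum_qstep hd hw, one_mul, stepEntropy, Finset.mul_sum]

lemma quenchedEntropy_eq_sum {G : SimpleGraph V} [DecidableRel G.Adj]
    (hd : ∀ v, ∃ u, G.Adj v u) {w : Sym2 V → ℝ} (hw : ∀ e ∈ G.edgeFinset, 0 < w e) (v0 : V)
    (T : ℕ) : quenchedEntropy G v0 w T =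
      ∑ t ∈ Finset.range T, expectAt G v0 w t (stepEntropy G w) := by
  induction T with
  | zero =>
    rw [Finset.sum_range_zero]
    refine Finset.sum_eq_zero fun x _ => ?_
    unfold quenchedProb
    split_ifs <;> simp
  | succ T ih => rw [quenchedEntropy_succ hd hw, ih, Finset.sum_range_succ]

lemma abs_expectAt_le {G : SimpleGraph V} [DecidableRel G.Adj] (hd : ∀ v, ∃ u, G.Adj v u)
    {w : Sym2 V → ℝ} (hw : ∀ e ∈ G.edgeFinset, 0 < w e) (v0 : V) (T : ℕ) {f : V → ℝ} {M : ℝ}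
    (hf : ∀ i, |f i| ≤ M) : |expectAt G v0 w T f| ≤ M := by
  calc |expectAt G v0 w T f| ≤ ∑ x, |quenchedProb G v0 w T x * f (x (Fin.last T))| :=
        Finset.abs_sum_le_sum_abs _ _
    _ ≤ ∑ x, quenchedProb G v0 w T x * M := Finset.sum_le_sum fun x _ => by
        rw [abs_mul, abs_of_nonneg (quenchedProb_nonneg hw v0 T x)]
        exact mul_le_mul_of_nonneg_left (hf _) (quenchedProb_nonneg hw v0 T x)
    _ = M := by rw [← Finset.sum_mul, sum_quenchedProb hd hw, one_mul]

lemma vw_mul_qstep {G : SimpleGraph V} [DecidableRel G.Adj] (hd : ∀ v, ∃ u, G.Adj v u)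
    {w : Sym2 V → ℝ} (hw : ∀ e ∈ G.edgeFinset, 0 < w e) (i j : V) :
    vw G w i * qstep G w i j = conductance G w i j := by
  rw [qstep_eq_conductance, mul_div_cancel₀ _ (vw_pos hd hw i).ne']

lemma sum_vw_mul_transitionOp {G : SimpleGraph V} [DecidableRel G.Adj]
    (hd : ∀ v, ∃ u, G.Adj v u) {w : Sym2 V → ℝ} (hw : ∀ e ∈ G.edgeFinset, 0 < w e) (f : V → ℝ) :
    ∑ i, vw G w i * transitionOp G w f i = ∑ i, vw G w i * f i := by
  simp only [transitionOp_apply, Finset.mul_sum, ← mul_assoc, vw_mul_qstep hd hw]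
  rw [Finset.sum_comm]
  refine Finset.sum_congr rfl fun j _ => ?_
  rw [vw_eq_sum_conductance, Finset.sum_mul]
  exact Finset.sum_congr rfl fun i _ => by rw [conductance_comm]

lemma eq_of_transitionOp_eq {G : SimpleGraph V} [DecidableRel G.Adj] (hG : G.Connected)
    (hd : ∀ v, ∃ u, G.Adj v u) {w : Sym2 V → ℝ} (hw : ∀ e ∈ G.edgeFinset, 0 < w e) {f : V → ℝ}
    (hf : transitionOp G w f = f) (i j : V) : f i = f j := by
  have h1 : ∑ i, ∑ j, conductance G w i j * (f i - f j) ^ 2 = 0 := by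
    have e1 : ∑ i, ∑ j, conductance G w i j * (f i * f j) = ∑ i, vw G w i * f i ^ 2 := by
      refine Finset.sum_congr rfl fun i _ => ?_
      have := congrFun hf i
      rw [transitionOp_apply] at this
      calc ∑ j, conductance G w i j * (f i * f j)
          = vw G w i * f i * ∑ j, qstep G w i j * f j := by
            rw [Finset.mul_sum]
            refine Finset.sum_congr rfl fun j _ => ?_
            rw [← vw_mul_qstep hd hw]
            ring
        _ = vw G w i * f i ^ 2 := by rw [this]; ring
    have e2 : ∑ i, ∑ j, conductance G w i j * f i ^ 2 = ∑ i, vw G w i * f i ^ 2 :=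
      Finset.sum_congr rfl fun i _ => by rw [vw_eq_sum_conductance, Finset.sum_mul]
    have e3 : ∑ i, ∑ j, conductance G w i j * f j ^ 2 = ∑ i, vw G w i * f i ^ 2 := by
      rw [Finset.sum_comm, ← e2]
      simp only [conductance_comm G w]
    have e4 : ∑ i, ∑ j, conductance G w i j * (f i - f j) ^ 2 =
        ∑ i, ∑ j, conductance G w i j * f i ^ 2 + ∑ i, ∑ j, conductance G w i j * f j ^ 2 -
          2 * ∑ i, ∑ j, conductance G w i j * (f i * f j) := by
      simp only [Finset.mul_sum, ← Finset.sum_add_distrib, ← Finset.sum_sub_distrib]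
      exact Finset.sum_congr rfl fun i _ => Finset.sum_congr rfl fun j _ => by ring
    rw [e4, e1, e2, e3]
    ring
  have hnn : ∀ i j, 0 ≤ conductance G w i j * (f i - f j) ^ 2 := fun i j =>
    mul_nonneg (conductance_nonneg hw i j) (sq_nonneg _)
  have hadj : ∀ i j, G.Adj i j → f i = f j := by
    intro i j h
    have h2 := (Finset.sum_eq_zero_iff_of_nonneg fun i _ =>
      Finset.sum_nonneg fun j _ => hnn i j).1 h1 i (Finset.mem_univ i)
    have h3 := (Finset.sum_eq_zero_iff_of_nonneg fun j _ => hnn i j).1 h2 j (Finset.mem_univ j)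
    have h4 : conductance G w i j ≠ 0 := by
      rw [conductance, if_pos h]
      exact (hw _ (SimpleGraph.mem_edgeFinset.2 h)).ne'
    exact sub_eq_zero.1 (pow_eq_zero_iff two_ne_zero |>.1 ((mul_eq_zero.1 h3).resolve_left h4))
  obtain ⟨p⟩ := hG.preconnected i j
  induction p with
  | nil => rfl
  | cons h _ ih => exact (hadj _ _ h).trans ih

/-- Solvability of the Poisson equation for the quenched chain. -/
lemma exists_poisson {G : SimpleGraph V} [DecidableRel G.Adj] (hG : G.Connected)
    (hd : ∀ v, ∃ u, G.Adj v u) {w : Sym2 V → ℝ} (hw : ∀ e ∈ G.edgeFinset, 0 < w e) (f : V → ℝ) :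
    ∃ g : V → ℝ, ∀ i, f i = ∑ k, statDist G w k * f k + (g i - transitionOp G w g i) := by
  have := hG.nonempty
  let L : (V → ℝ) →ₗ[ℝ] V → ℝ := LinearMap.id - transitionOp G w
  let p : (V → ℝ) →ₗ[ℝ] ℝ := ∑ i, vw G w i • LinearMap.proj i
  have hp : ∀ g, p g = ∑ i, vw G w i * g i := fun g => by simp [p]
  have hp0 : p ≠ 0 := fun h => by
    have h1 : p 1 = 0 := by rw [h]; rfl
    rw [hp] at h1
    simp only [Pi.one_apply, mul_one] at h1
    exact (Finset.sum_pos (fun i _ => vw_pos hd hw i) Finset.univ_nonempty).ne' h1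
  have hle : LinearMap.range L ≤ LinearMap.ker p := by
    rintro _ ⟨g, rfl⟩
    rw [LinearMap.mem_ker, hp]
    simp [L, mul_sub, Finset.sum_sub_distrib, sum_vw_mul_transitionOp hd hw]
  have hker : LinearMap.ker L ≤ Submodule.span ℝ {(1 : V → ℝ)} := by
    intro g hg
    have hg' : transitionOp G w g = g := (sub_eq_zero.1 (LinearMap.mem_ker.1 hg)).symm
    obtain ⟨v⟩ := this
    refine Submodule.mem_span_singleton.2 ⟨g v, ?_⟩
    ext i
    simp [eq_of_transitionOp_eq hG hd hw hg' v i]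
  have h1 : Module.finrank ℝ (LinearMap.ker L) ≤ 1 :=
    (Submodule.finrank_mono hker).trans (finrank_span_singleton one_ne_zero).le
  have h2 := LinearMap.finrank_range_add_finrank_ker L
  have h3 := Module.Dual.finrank_ker_add_one_of_ne_zero (f := p) hp0
  have heq : LinearMap.range L = LinearMap.ker p :=
    Submodule.eq_of_le_of_finrank_le hle (by omega)
  set c := ∑ k, statDist G w k * f k with hc
  have hmem : (fun i => f i - c) ∈ LinearMap.ker p := by
    rw [LinearMap.mem_ker, hp]
    have hW : ∑ v, vw G w v ≠ 0 :=
      (Finset.sum_pos (fun i _ => vw_pos hd hw i) Finset.univ_nonempty).ne'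
    simp only [mul_sub, Finset.sum_sub_distrib, ← Finset.sum_mul]
    rw [hc, Finset.mul_sum, sub_eq_zero]
    refine Finset.sum_congr rfl fun i _ => ?_
    rw [statDist]
    field_simp
  rw [← heq] at hmem
  obtain ⟨g, hg⟩ := hmem
  refine ⟨g, fun i => ?_⟩
  have := congrFun hg i
  simp only [L, LinearMap.sub_apply, LinearMap.id_apply, Pi.sub_apply] at this
  linarith

/-- Entropy rate of the quenched chain. -/
def quenchedRate (G : SimpleGraph V) [DecidableRel G.Adj] (w : Sym2 V → ℝ) : ℝ :=
  ∑ i, statDist G w i * stepEntropy G w i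

lemma tendsto_quenchedEntropy {G : SimpleGraph V} [DecidableRel G.Adj] (hG : G.Connected)
    (hd : ∀ v, ∃ u, G.Adj v u) {w : Sym2 V → ℝ} (hw : ∀ e ∈ G.edgeFinset, 0 < w e) (v0 : V) :
    Tendsto (fun T : ℕ => quenchedEntropy G v0 w T / T) atTop (nhds (quenchedRate G w)) := by
  obtain ⟨g, hg⟩ := exists_poisson hG hd hw (stepEntropy G w)
  have hsum : ∀ T : ℕ, quenchedEntropy G v0 w T =
      T * quenchedRate G w + (g v0 - expectAt G v0 w T g) := by
    intro T
    induction T with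
    | zero =>
      rw [quenchedEntropy_eq_sum hd hw, expectAt_zero]
      simp
    | succ T ih =>
      have h1 : expectAt G v0 w T (stepEntropy G w) = quenchedRate G w +
          (expectAt G v0 w T g - expectAt G v0 w (T + 1) g) := by
        rw [expectAt_succ, ← one_mul (quenchedRate G w), ← sum_quenchedProb hd hw v0 T]
        unfold expectAt
        rw [← Finset.sum_sub_distrib, Finset.sum_mul, ← Finset.sum_add_distrib]
        refine Finset.sum_congr rfl fun x _ => ?_
        rw [hg (x (Fin.last T)), ← quenchedRate]
        ring
      rw [quenchedEntropy_succ hd hw, ih, h1]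
      push_cast
      ring
  have hM : ∀ i, |g i| ≤ ∑ k, |g k| := fun i =>
    Finset.single_le_sum (f := fun k => |g k|) (fun k _ => abs_nonneg _) (Finset.mem_univ i)
  have h0 : Tendsto (fun T : ℕ => (g v0 - expectAt G v0 w T g) / T) atTop (nhds 0) := by
    refine squeeze_zero_norm (a := fun T : ℕ => (2 * ∑ k, |g k|) / T) (fun T => ?_)
      (tendsto_const_div_atTop_nhds_zero_nat _)
    rw [norm_div, Real.norm_natCast]
    refine div_le_div_of_nonneg_right ?_ (Nat.cast_nonneg T)
    calc |g v0 - expectAt G v0 w T g| ≤ |g v0| + |expectAt G v0 w T g| := abs_sub _ _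
      _ ≤ 2 * ∑ k, |g k| := by linarith [hM v0, abs_expectAt_le hd hw v0 T hM]
  have h1 := h0.const_add (quenchedRate G w)
  rw [add_zero] at h1
  refine h1.congr' ?_
  filter_upwards [eventually_gt_atTop 0] with T hT
  have : (T : ℝ) ≠ 0 := by positivity
  rw [hsum]
  field_simp

lemma abs_quenchedEntropy_div_le {G : SimpleGraph V} [DecidableRel G.Adj]
    (hd : ∀ v, ∃ u, G.Adj v u) {w : Sym2 V → ℝ} (hw : ∀ e ∈ G.edgeFinset, 0 < w e) (v0 : V)
    (T : ℕ) : |quenchedEntropy G v0 w T / T| ≤ Fintype.card V := by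
  have h1 : |quenchedEntropy G v0 w T| ≤ T * Fintype.card V := by
    rw [quenchedEntropy_eq_sum hd hw]
    refine (Finset.abs_sum_le_sum_abs _ _).trans ?_
    refine (Finset.sum_le_sum fun t _ => abs_expectAt_le hd hw v0 t (M := Fintype.card V)
      fun i => ?_).trans (by simp)
    rw [abs_of_nonneg (stepEntropy_nonneg hd hw i)]
    exact stepEntropy_le hw i
  rw [abs_div, Nat.abs_cast]
  refine div_le_of_le_mul₀ (Nat.cast_nonneg _) (Nat.cast_nonneg _) ?_
  rwa [mul_comm]

/-- Number of directed traversals of `p` along the path `x`. -/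
def arcCount {T : ℕ} (v0 : V) (x : Fin (T + 1) → V) (p : V × V) : ℕ :=
  ((Finset.range T).filter fun t => (extendPath v0 x t, extendPath v0 x (t + 1)) = p).card

/-- The starting point of a path together with its directed traversal counts. -/
def pathType {T : ℕ} (v0 : V) (x : Fin (T + 1) → V) : V × (V × V → Fin (T + 1)) :=
  (x 0, fun p => ⟨arcCount v0 x p, Nat.lt_succ_of_le
    ((Finset.card_filter_le _ _).trans_eq (Finset.card_range T))⟩)

lemma quenchedProb_eq_of_pathType_eq (G : SimpleGraph V) [DecidableRel G.Adj] (v0 : V)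
    (w : Sym2 V → ℝ) {T : ℕ} {x y : Fin (T + 1) → V} (h : pathType v0 x = pathType v0 y) :
    quenchedProb G v0 w T x = quenchedProb G v0 w T y := by
  have key : ∀ z : Fin (T + 1) → V,
      ∏ t ∈ Finset.range T, qstep G w (extendPath v0 z t) (extendPath v0 z (t + 1)) =
        ∏ p : V × V, qstep G w p.1 p.2 ^ arcCount v0 z p := by
    intro z
    rw [← Finset.prod_fiberwise (Finset.range T)
      fun t => (extendPath v0 z t, extendPath v0 z (t + 1))]
    refine Finset.prod_congr rfl fun p _ => ?_
    rw [arcCount, ← Finset.prod_const]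
    refine Finset.prod_congr rfl fun t ht => ?_
    rw [← (Finset.mem_filter.1 ht).2]
  have h0 : x 0 = y 0 := congrArg Prod.fst h
  have h1 : ∀ p, arcCount v0 x p = arcCount v0 y p := fun p =>
    congrArg Fin.val (congrFun (congrArg Prod.snd h) p)
  simp only [quenchedProb, key, h0, h1]

/-- Number of paths sharing the type of `x`. -/
def typeSize {T : ℕ} (v0 : V) (x : Fin (T + 1) → V) : ℕ :=
  (Finset.univ.filter fun y => pathType v0 y = pathType v0 x).card

lemma typeSize_pos {T : ℕ} (v0 : V) (x : Fin (T + 1) → V) : 0 < typeSize v0 x :=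
  Finset.card_pos.2 ⟨x, by simp⟩

lemma sum_inv_typeSize_le (v0 : V) (T : ℕ) :
    ∑ x : Fin (T + 1) → V, (typeSize v0 x : ℝ)⁻¹ ≤
      Fintype.card (V × (V × V → Fin (T + 1))) := by
  rw [← Finset.sum_fiberwise Finset.univ fun x : Fin (T + 1) → V => pathType v0 x]
  refine (Finset.sum_le_sum fun c _ => ?_).trans
    (by simp : ∑ _c : V × (V × V → Fin (T + 1)), (1 : ℝ) ≤ _)
  have h : ∀ x ∈ Finset.univ.filter (fun x : Fin (T + 1) → V => pathType v0 x = c),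
      (typeSize v0 x : ℝ)⁻¹ =
        ((Finset.univ.filter fun x : Fin (T + 1) → V => pathType v0 x = c).card : ℝ)⁻¹ := by
    intro x hx
    rw [typeSize, (Finset.mem_filter.1 hx).2]
  rw [Finset.sum_congr rfl h, Finset.sum_const, nsmul_eq_mul]
  exact mul_inv_le_one

lemma mul_log_typeSize_le {G : SimpleGraph V} [DecidableRel G.Adj] (hd : ∀ v, ∃ u, G.Adj v u)
    {w : Sym2 V → ℝ} (hw : ∀ e ∈ G.edgeFinset, 0 < w e) (v0 : V) {T : ℕ}
    (x : Fin (T + 1) → V) :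
    quenchedProb G v0 w T x * Real.log (typeSize v0 x) ≤
      negMulLog (quenchedProb G v0 w T x) := by
  rcases (quenchedProb_nonneg hw v0 T x).eq_or_lt with h0 | h0
  · simp [← h0]
  have hN : (0 : ℝ) < typeSize v0 x := Nat.cast_pos.2 (typeSize_pos v0 x)
  have h1 : typeSize v0 x * quenchedProb G v0 w T x ≤ 1 := by
    have h2 : ∑ y ∈ Finset.univ.filter (fun y => pathType v0 y = pathType v0 x),
        quenchedProb G v0 w T y = typeSize v0 x * quenchedProb G v0 w T x := by
      rw [Finset.sum_congr rfl fun y hy =>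
        quenchedProb_eq_of_pathType_eq G v0 w (Finset.mem_filter.1 hy).2, Finset.sum_const,
        nsmul_eq_mul, typeSize]
    rw [← h2, ← sum_quenchedProb hd hw v0 T]
    exact Finset.sum_le_sum_of_subset_of_nonneg (Finset.filter_subset _ _)
      fun y _ _ => quenchedProb_nonneg hw v0 T y
  have h3 : Real.log (typeSize v0 x) + Real.log (quenchedProb G v0 w T x) ≤ 0 := by
    rw [← Real.log_mul hN.ne' h0.ne']
    exact Real.log_nonpos (by positivity) h1
  rw [negMulLog]
  nlinarith

/-- Gibbs' inequality against the law that is uniform on types and then on each type. -/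
lemma sum_negMulLog_le {T : ℕ} (v0 : V) {p : (Fin (T + 1) → V) → ℝ} (hp : ∀ x, 0 ≤ p x)
    (hp1 : ∑ x, p x = 1) :
    ∑ x, negMulLog (p x) ≤ Real.log (Fintype.card (V × (V × V → Fin (T + 1)))) +
      ∑ x, p x * Real.log (typeSize v0 x) := by
  have : Nonempty V := ⟨v0⟩
  set C : ℝ := (Fintype.card (V × (V × V → Fin (T + 1))) : ℝ)
  have hCpos : 0 < C := Nat.cast_pos.2 Fintype.card_pos
  have h1 : ∀ x, negMulLog (p x) - p x * Real.log (typeSize v0 x) - p x * Real.log C ≤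
      C⁻¹ * (typeSize v0 x : ℝ)⁻¹ - p x := by
    intro x
    have hN : (0 : ℝ) < typeSize v0 x := Nat.cast_pos.2 (typeSize_pos v0 x)
    rcases (hp x).eq_or_lt with h0 | h0
    · rw [← h0]
      simp only [negMulLog_zero, zero_mul, sub_zero]
      positivity
    have h2 := Real.log_le_sub_one_of_pos (x := C⁻¹ * (typeSize v0 x : ℝ)⁻¹ * (p x)⁻¹)
      (by positivity)
    rw [Real.log_mul (by positivity) (by positivity), Real.log_mul (by positivity)
      (by positivity), Real.log_inv, Real.log_inv, Real.log_inv] at h2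
    have h3 := mul_le_mul_of_nonneg_left h2 h0.le
    have h4 : p x * (C⁻¹ * (typeSize v0 x : ℝ)⁻¹ * (p x)⁻¹ - 1) =
        C⁻¹ * (typeSize v0 x : ℝ)⁻¹ - p x := by
      field_simp
    rw [h4] at h3
    rw [negMulLog]
    linarith
  have h5 := Finset.sum_le_sum fun x (_ : x ∈ Finset.univ) => h1 x
  simp only [Finset.sum_sub_distrib, ← Finset.mul_sum, ← Finset.sum_mul, hp1] at h5
  have h6 : C⁻¹ * ∑ x : Fin (T + 1) → V, (typeSize v0 x : ℝ)⁻¹ ≤ 1 := by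
    rw [inv_mul_le_iff₀ hCpos, mul_one]
    exact sum_inv_typeSize_le v0 T
  linarith

lemma tendsto_log_card_div (v0 : V) : Tendsto (fun T : ℕ =>
    Real.log (Fintype.card (V × (V × V → Fin (T + 1)))) / T) atTop (nhds 0) := by
  have : Nonempty V := ⟨v0⟩
  have hV : (Fintype.card V : ℝ) ≠ 0 := Nat.cast_ne_zero.2 Fintype.card_ne_zero
  have h1 : Tendsto (fun T : ℕ => Real.log (T + 1 : ℝ) / T) atTop (nhds 0) := by
    have h2 : Tendsto (fun T : ℕ => Real.log ((T + 1 : ℕ) : ℝ) / ((T + 1 : ℕ) : ℝ)) atTop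
        (nhds 0) := by
      have := (Real.isLittleO_log_id_atTop.tendsto_div_nhds_zero).comp
        (tendsto_natCast_atTop_atTop.comp (tendsto_add_atTop_nat 1))
      exact this
    have h3 : Tendsto (fun T : ℕ => 1 + 1 / (T : ℝ)) atTop (nhds (1 + 0)) :=
      (tendsto_const_div_atTop_nhds_zero_nat 1).const_add 1
    have h4 := h2.mul h3
    rw [zero_mul] at h4
    refine h4.congr' ?_
    filter_upwards [eventually_gt_atTop 0] with T hT
    have : (T : ℝ) ≠ 0 := by positivity
    have : (T : ℝ) + 1 ≠ 0 := by positivity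
    push_cast
    field_simp
  have h5 := (tendsto_const_div_atTop_nhds_zero_nat (Real.log (Fintype.card V))).add
    (h1.const_mul ((Fintype.card V * Fintype.card V : ℕ) : ℝ))
  rw [mul_zero, add_zero] at h5
  refine h5.congr fun T => ?_
  have : (T : ℝ) + 1 ≠ 0 := by positivity
  simp only [Fintype.card_prod, Fintype.card_fun, Fintype.card_fin]
  push_cast
  rw [Real.log_mul hV (pow_ne_zero _ this), Real.log_pow]
  push_cast
  ring

lemma measurable_quenchedEntropy (G : SimpleGraph V) [DecidableRel G.Adj] (v0 : V) (T : ℕ) :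
    Measurable fun w => quenchedEntropy G v0 w T :=
  Finset.measurable_fun_sum _ fun x _ =>
    continuous_negMulLog.measurable.comp (measurable_quenchedProb G v0 T x)

lemma integrable_quenchedProb {G : SimpleGraph V} [DecidableRel G.Adj] (hG : G.Connected)
    (hd : ∀ v, ∃ u, G.Adj v u) {e0 : Sym2 V} (he0 : e0 ∈ G.edgeFinset) (v0 : V) {a : Sym2 V → ℝ}
    (ha : ∀ e ∈ G.edgeFinset, 0 < a e) (T : ℕ) (x : Fin (T + 1) → V) :
    Integrable (fun w => quenchedProb G v0 w T x) (mixing G e0 v0 a) := by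
  have := isProbabilityMeasure_mixing hG hd he0 v0 ha
  refine Integrable.of_bound (measurable_quenchedProb G v0 T x).aestronglyMeasurable 1 ?_
  filter_upwards [ae_mixing_pos G e0 v0 a] with w hw
  rw [Real.norm_of_nonneg (quenchedProb_nonneg hw v0 T x)]
  exact quenchedProb_le_one hd hw v0 T x

lemma integral_quenchedProb {G : SimpleGraph V} [DecidableRel G.Adj] (hG : G.Connected)
    (hd : ∀ v, ∃ u, G.Adj v u) {e0 : Sym2 V} (he0 : e0 ∈ G.edgeFinset) (v0 : V) {a : Sym2 V → ℝ}
    (ha : ∀ e ∈ G.edgeFinset, 0 < a e) (T : ℕ) (x : Fin (T + 1) → V) :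
    ∫ w, quenchedProb G v0 w T x ∂mixing G e0 v0 a = errwProb G v0 a T x := by
  rw [integral_eq_lintegral_of_nonneg_ae _
    (measurable_quenchedProb G v0 T x).aestronglyMeasurable,
    lintegral_quenchedProb hG hd he0 v0 ha, ENNReal.toReal_ofReal (errwProb_nonneg ha v0 T x)]
  filter_upwards [ae_mixing_pos G e0 v0 a] with w hw
  exact quenchedProb_nonneg hw v0 T x

lemma integrable_negMulLog_quenchedProb {G : SimpleGraph V} [DecidableRel G.Adj]
    (hG : G.Connected) (hd : ∀ v, ∃ u, G.Adj v u) {e0 : Sym2 V} (he0 : e0 ∈ G.edgeFinset)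
    (v0 : V) {a : Sym2 V → ℝ} (ha : ∀ e ∈ G.edgeFinset, 0 < a e) (T : ℕ)
    (x : Fin (T + 1) → V) :
    Integrable (fun w => negMulLog (quenchedProb G v0 w T x)) (mixing G e0 v0 a) := by
  have := isProbabilityMeasure_mixing hG hd he0 v0 ha
  refine Integrable.of_bound (continuous_negMulLog.measurable.comp
    (measurable_quenchedProb G v0 T x)).aestronglyMeasurable 1 ?_
  filter_upwards [ae_mixing_pos G e0 v0 a] with w hw
  have h0 := quenchedProb_nonneg hw v0 T x
  rw [Real.norm_of_nonneg (negMulLog_nonneg h0 (quenchedProb_le_one hd hw v0 T x))]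
  linarith [negMulLog_le_one_sub_self h0]

lemma sum_errwProb {G : SimpleGraph V} [DecidableRel G.Adj] (hG : G.Connected)
    (hd : ∀ v, ∃ u, G.Adj v u) {e0 : Sym2 V} (he0 : e0 ∈ G.edgeFinset) (v0 : V) {a : Sym2 V → ℝ}
    (ha : ∀ e ∈ G.edgeFinset, 0 < a e) (T : ℕ) : ∑ x, errwProb G v0 a T x = 1 := by
  have := isProbabilityMeasure_mixing hG hd he0 v0 ha
  simp only [← integral_quenchedProb hG hd he0 v0 ha]
  rw [← integral_finsetSum _ fun x _ => integrable_quenchedProb hG hd he0 v0 ha T x]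
  have h : ∀ᵐ w ∂mixing G e0 v0 a, ∑ x, quenchedProb G v0 w T x = 1 := by
    filter_upwards [ae_mixing_pos G e0 v0 a] with w hw using sum_quenchedProb hd hw v0 T
  rw [integral_congr_ae h]
  simp

lemma integral_quenchedEntropy_le {G : SimpleGraph V} [DecidableRel G.Adj] (hG : G.Connected)
    (hd : ∀ v, ∃ u, G.Adj v u) {e0 : Sym2 V} (he0 : e0 ∈ G.edgeFinset) (v0 : V) {a : Sym2 V → ℝ}
    (ha : ∀ e ∈ G.edgeFinset, 0 < a e) (T : ℕ) :
    ∫ w, quenchedEntropy G v0 w T ∂mixing G e0 v0 a ≤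
      ∑ x, negMulLog (errwProb G v0 a T x) := by
  have := isProbabilityMeasure_mixing hG hd he0 v0 ha
  unfold quenchedEntropy
  rw [integral_finsetSum _ fun x _ =>
    integrable_negMulLog_quenchedProb hG hd he0 v0 ha T x]
  refine Finset.sum_le_sum fun x _ => ?_
  rw [← integral_quenchedProb hG hd he0 v0 ha]
  refine concaveOn_negMulLog.le_map_integral continuous_negMulLog.continuousOn isClosed_Ici ?_
    (integrable_quenchedProb hG hd he0 v0 ha T x)
    (integrable_negMulLog_quenchedProb hG hd he0 v0 ha T x)
  filter_upwards [ae_mixing_pos G e0 v0 a] with w hw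
  exact quenchedProb_nonneg hw v0 T x

lemma errwEntropy_le {G : SimpleGraph V} [DecidableRel G.Adj] (hG : G.Connected)
    (hd : ∀ v, ∃ u, G.Adj v u) {e0 : Sym2 V} (he0 : e0 ∈ G.edgeFinset) (v0 : V) {a : Sym2 V → ℝ}
    (ha : ∀ e ∈ G.edgeFinset, 0 < a e) (T : ℕ) :
    ∑ x, negMulLog (errwProb G v0 a T x) ≤
      ∫ w, quenchedEntropy G v0 w T ∂mixing G e0 v0 a +
        Real.log (Fintype.card (V × (V × V → Fin (T + 1)))) := by
  have h1 : ∑ x, errwProb G v0 a T x * Real.log (typeSize v0 x) ≤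
      ∫ w, quenchedEntropy G v0 w T ∂mixing G e0 v0 a := by
    unfold quenchedEntropy
    rw [integral_finsetSum _ fun x _ =>
      integrable_negMulLog_quenchedProb hG hd he0 v0 ha T x]
    refine Finset.sum_le_sum fun x _ => ?_
    rw [← integral_quenchedProb hG hd he0 v0 ha, ← integral_mul_const]
    refine integral_mono_ae ((integrable_quenchedProb hG hd he0 v0 ha T x).mul_const _)
      (integrable_negMulLog_quenchedProb hG hd he0 v0 ha T x) ?_
    filter_upwards [ae_mixing_pos G e0 v0 a] with w hw
    exact mul_log_typeSize_le hd hw v0 x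
  linarith [sum_negMulLog_le v0 (errwProb_nonneg ha v0 T) (sum_errwProb hG hd he0 v0 ha T)]

lemma tendsto_integral_quenchedEntropy {G : SimpleGraph V} [DecidableRel G.Adj]
    (hG : G.Connected) (hd : ∀ v, ∃ u, G.Adj v u) {e0 : Sym2 V} (he0 : e0 ∈ G.edgeFinset)
    (v0 : V) {a : Sym2 V → ℝ} (ha : ∀ e ∈ G.edgeFinset, 0 < a e) :
    Tendsto (fun T : ℕ => (∫ w, quenchedEntropy G v0 w T ∂mixing G e0 v0 a) / T) atTop
      (nhds (∫ w, quenchedRate G w ∂mixing G e0 v0 a)) := by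
  have := isProbabilityMeasure_mixing hG hd he0 v0 ha
  simp only [← integral_div]
  refine tendsto_integral_of_dominated_convergence (fun _ => (Fintype.card V : ℝ))
    (fun T => ((measurable_quenchedEntropy G v0 T).div_const _).aestronglyMeasurable)
    (integrable_const _) (fun T => ?_) ?_
  · filter_upwards [ae_mixing_pos G e0 v0 a] with w hw
    exact abs_quenchedEntropy_div_le hd hw v0 T
  · filter_upwards [ae_mixing_pos G e0 v0 a] with w hw
    exact tendsto_quenchedEntropy hG hd hw v0

lemma tendsto_errwEntropy {G : SimpleGraph V} [DecidableRel G.Adj]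
    (hG : G.Connected) (hd : ∀ v, ∃ u, G.Adj v u) {e0 : Sym2 V} (he0 : e0 ∈ G.edgeFinset)
    (v0 : V) {a : Sym2 V → ℝ} (ha : ∀ e ∈ G.edgeFinset, 0 < a e) :
    Tendsto (fun T : ℕ => (∑ x, negMulLog (errwProb G v0 a T x)) / T) atTop
      (nhds (∫ w, quenchedRate G w ∂mixing G e0 v0 a)) := by
  have h1 := tendsto_integral_quenchedEntropy hG hd he0 v0 ha
  have h2 := h1.add (tendsto_log_card_div v0)
  rw [add_zero] at h2
  refine tendsto_of_tendsto_of_tendsto_of_le_of_le h1 h2 (fun T => ?_) fun T => ?_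
  · exact div_le_div_of_nonneg_right (integral_quenchedEntropy_le hG hd he0 v0 ha T)
      (Nat.cast_nonneg T)
  · simp only [← add_div]
    exact div_le_div_of_nonneg_right (errwEntropy_le hG hd he0 v0 ha T) (Nat.cast_nonneg T)

lemma quenchedRate_eq {G : SimpleGraph V} [DecidableRel G.Adj] (w : Sym2 V → ℝ) :
    quenchedRate G w =
      -∑ i : V, statDist G w i * ∑ j : V, qstep G w i j * Real.log (qstep G w i j) := by
  simp [quenchedRate, stepEntropy, negMulLog]

/-- The entropy rate of a reversible chain as a sum over edges. -/
lemma quenchedRate_eq_sum_edgeFinset {G : SimpleGraph V} [DecidableRel G.Adj]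
    (hd : ∀ v, ∃ u, G.Adj v u) {w : Sym2 V → ℝ} (hw : ∀ e ∈ G.edgeFinset, 0 < w e) :
    quenchedRate G w = -∑ e ∈ G.edgeFinset, (w e / ∑ g ∈ G.edgeFinset, w g) *
      Real.log (w e / Real.sqrt (sprod (vw G w) e)) := by
  set S := ∑ g ∈ G.edgeFinset, w g with hS
  have h1 : ∀ i, statDist G w i * ∑ j : V, qstep G w i j * Real.log (qstep G w i j) =
      ∑ j ∈ G.neighborFinset i, w s(i, j) / (2 * S) * Real.log (w s(i, j) / vw G w i) := by
    intro i
    have hi := (vw_pos hd hw i).ne'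
    rw [statDist, sum_vw, ← hS, Finset.mul_sum]
    have h2 : ∀ j, vw G w i / (2 * S) * (qstep G w i j * Real.log (qstep G w i j)) =
        if G.Adj i j then w s(i, j) / (2 * S) * Real.log (w s(i, j) / vw G w i) else 0 := by
      intro j
      unfold qstep
      split_ifs
      · field_simp
      · simp
    simp only [h2]
    rw [← Finset.sum_filter]
    refine Finset.sum_congr ?_ fun _ _ => rfl
    ext j
    simp
  rw [quenchedRate_eq]
  simp only [h1]
  rw [sum_neighborFinset_eq_sum_edgeFinset G
    fun i j => w s(i, j) / (2 * S) * Real.log (w s(i, j) / vw G w i)]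
  congr 1
  refine Finset.sum_congr rfl fun e he => ?_
  have hwe := hw e he
  induction e with | _ i j
  have hi := vw_pos hd hw i
  have hj := vw_pos hd hw j
  simp only [Sym2.lift_mk, sprod, Sym2.eq_swap (a := j)]
  rw [Real.log_div hwe.ne' hi.ne', Real.log_div hwe.ne' hj.ne',
    Real.log_div hwe.ne' (Real.sqrt_pos.2 (mul_pos hi hj)).ne', Real.log_sqrt (mul_pos hi hj).le,
    Real.log_mul hi.ne' hj.ne']
  ring

/-- Annealed entropy-rate formula.  The entropy rate of the ERRW on
`(G, v0, A)` exists and equals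
`−∫ Σ_{{i,j}∈E} (w_{ij}/Σ_e w_e)·log(w_{ij}/√(w_i w_j)) dμ_{v0,A}(w)`, which in turn equals
the annealed average `E_{W∼μ}[r(P_W)]` of the quenched entropy rates. -/
theorem entropy_rate_annealed
    {V : Type*} [Fintype V] [DecidableEq V]
    (G : SimpleGraph V) [DecidableRel G.Adj] (hG : G.Connected)
    (v0 : V) (e0 : Sym2 V) (he0 : e0 ∈ G.edgeFinset)
    (a : Sym2 V → ℝ) (ha : ∀ e ∈ G.edgeFinset, 0 < a e) :
    Filter.Tendsto
      (fun T : ℕ =>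
        (-∑ x : Fin (T + 1) → V,
            errwProb G v0 a T x * Real.log (errwProb G v0 a T x)) / T)
      Filter.atTop
      (nhds (-∫ w, (∑ e ∈ G.edgeFinset,
          (w e / ∑ g ∈ G.edgeFinset, w g) *
            Real.log (w e / Real.sqrt (sprod (vw G w) e))) ∂(mixing G e0 v0 a)))
    ∧
    (-∫ w, (∑ e ∈ G.edgeFinset,
          (w e / ∑ g ∈ G.edgeFinset, w g) *
            Real.log (w e / Real.sqrt (sprod (vw G w) e))) ∂(mixing G e0 v0 a))
      = ∫ w, (-∑ i : V, statDist G w i *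
            ∑ j : V, qstep G w i j * Real.log (qstep G w i j)) ∂(mixing G e0 v0 a) := by
  have hd : ∀ v, ∃ u, G.Adj v u := by
    induction e0 with | _ p q
    have : Nontrivial V := ⟨p, q, (SimpleGraph.mem_edgeFinset.1 he0 : G.Adj p q).ne⟩
    exact fun v => hG.preconnected.exists_adj_of_nontrivial v
  have h1 : ∫ w, quenchedRate G w ∂mixing G e0 v0 a =
      -∫ w, (∑ e ∈ G.edgeFinset, (w e / ∑ g ∈ G.edgeFinset, w g) *
        Real.log (w e / Real.sqrt (sprod (vw G w) e))) ∂mixing G e0 v0 a := by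
    rw [← integral_neg]
    refine integral_congr_ae ?_
    filter_upwards [ae_mixing_pos G e0 v0 a] with w hw
    exact quenchedRate_eq_sum_edgeFinset hd hw
  refine ⟨?_, ?_⟩
  · rw [← h1]
    refine (tendsto_errwEntropy hG hd he0 v0 ha).congr fun T => ?_
    simp [negMulLog]
  · rw [← h1]
    simp only [quenchedRate_eq]

end ERRW
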